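/- The Liouville function λ (the completely multiplicative function with λ(p) = −1 for every prime p) does not satisfy Pólya's inequality ∑_{i=1}^{n} λ(i) ≤ 0 for all n ≥ 2; in fact there exists n ≥ 2 (e.g. n = 906150257) with ∑_{i=1}^{n} λ(i) > 0. -/

import Mathlib

open Finset

/-- The Liouville function `λ(n) = (-1)^{Ω(n)}`, where `Ω(n)` is the number of prime
factors of `n` counted with multiplicity. -/
def liouvilleFn (n : ℕ) : ℤ := (-1) ^ n.primeFactorsList.length

set_option maxRecDepth 100000

namespace Pol

/-! ### Number theory -/

/-- Indicator of the positive squares. -/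
noncomputable def sqInd : ArithmeticFunction ℤ where
  toFun n := if n ≠ 0 ∧ IsSquare n then 1 else 0
  map_zero' := by simp

lemma sqInd_apply (n : ℕ) : sqInd n = if n ≠ 0 ∧ IsSquare n then 1 else 0 := rfl

lemma isSquare_mul_of_coprime {m n : ℕ} (h : m.Coprime n) :
    IsSquare (m * n) ↔ IsSquare m ∧ IsSquare n := by
  constructor
  · rintro ⟨c, hc⟩
    have hc' : m * n = c ^ 2 := by rw [hc, sq]
    obtain ⟨a, ha⟩ := exists_eq_pow_of_mul_eq_pow (Nat.isUnit_iff.2 h) hc'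
    obtain ⟨b, hb⟩ := exists_eq_pow_of_mul_eq_pow (Nat.isUnit_iff.2 h.symm) ((mul_comm n m).trans hc')
    exact ⟨⟨a, by rw [ha, sq]⟩, ⟨b, by rw [hb, sq]⟩⟩
  · rintro ⟨h1, h2⟩
    exact h1.mul h2

lemma isMultiplicative_sqInd : sqInd.IsMultiplicative := by
  refine ⟨by simp [sqInd_apply], ?_⟩
  intro m n h
  simp only [sqInd_apply, isSquare_mul_of_coprime h, mul_ne_zero_iff]
  split_ifs <;> simp_all

lemma isSquare_prime_pow {p i : ℕ} (hp : p.Prime) : IsSquare (p ^ i) ↔ Even i := by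
  constructor
  · rintro ⟨c, hc⟩
    have := congrArg (fun t => t.factorization p) hc
    have hc0 : c ≠ 0 := by
      rintro rfl
      exact (pow_ne_zero i hp.ne_zero) (by simpa using hc)
    simp only [Nat.factorization_mul hc0 hc0, hp.factorization_pow] at this
    simp at this
    exact ⟨_, this⟩
  · intro h
    exact h.isSquare_pow p

lemma liouville_mul_zeta : ArithmeticFunction.liouville * (ArithmeticFunction.zeta : ArithmeticFunction ℤ) = sqInd := by
  rw [ArithmeticFunction.IsMultiplicative.eq_iff_eq_on_prime_powers _
    (ArithmeticFunction.isMultiplicative_liouville.mul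
      (ArithmeticFunction.isMultiplicative_zeta.natCast)) _ isMultiplicative_sqInd]
  intro p i hp
  rw [ArithmeticFunction.coe_mul_zeta_apply, Nat.sum_divisors_prime_pow hp, sqInd_apply]
  have h0 : p ^ i ≠ 0 := pow_ne_zero i hp.ne_zero
  have : ∀ k ∈ range (i + 1), ArithmeticFunction.liouville (p ^ k) = (-1) ^ k := by
    intro k _
    rw [ArithmeticFunction.liouville_apply (pow_ne_zero k hp.ne_zero),
      ArithmeticFunction.cardFactors_apply_prime_pow hp]
  rw [sum_congr rfl this]
  simp only [isSquare_prime_pow hp, h0, ne_eq, not_false_eq_true, true_and]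
  clear this h0
  rw [neg_one_geom_sum]
  rcases Nat.even_or_odd i with h | h
  · rw [if_neg (by simpa using h.add_one), if_pos h]
  · rw [if_pos (by simpa using h.add_one), if_neg (by simpa using h)]

/-- The summatory function. -/
def LL (y : ℕ) : ℤ := ∑ i ∈ Icc 1 y, liouvilleFn i

lemma LL_eq (y : ℕ) : LL y = ∑ i ∈ Ioc 0 y, ArithmeticFunction.liouville i := by
  refine sum_congr rfl ?_
  intro i hi
  rw [mem_Ioc] at hi
  rw [ArithmeticFunction.liouville_apply (by omega)]
  rfl

lemma LL_succ (y : ℕ) : LL (y + 1) = LL y + liouvilleFn (y + 1) := by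
  unfold LL
  rw [sum_Icc_succ_top (by omega)]

lemma sum_sqInd (y : ℕ) : ∑ n ∈ Ioc 0 y, sqInd n = Nat.sqrt y := by
  simp only [sqInd_apply]
  rw [sum_boole]
  have : (filter (fun n => n ≠ 0 ∧ IsSquare n) (Ioc 0 y)) = (Ioc 0 (Nat.sqrt y)).image (fun a => a * a) := by
    ext n
    simp only [mem_filter, mem_Ioc, mem_image, Nat.le_sqrt]
    constructor
    · rintro ⟨⟨h1, h2⟩, -, ⟨a, rfl⟩⟩
      exact ⟨a, ⟨Nat.pos_of_mul_pos_left h1, h2⟩, rfl⟩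
    · rintro ⟨a, ⟨h1, h2⟩, rfl⟩
      exact ⟨⟨Nat.mul_pos h1 h1, h2⟩, (Nat.mul_pos h1 h1).ne', ⟨a, rfl⟩⟩
  rw [this, card_image_of_injective _ (fun a b h => by simpa using Nat.mul_self_inj.1 h)]
  simp

lemma sum_LL (y : ℕ) : ∑ k ∈ Ioc 0 y, LL (y / k) = Nat.sqrt y := by
  rw [← sum_sqInd, ← liouville_mul_zeta, mul_comm, ArithmeticFunction.sum_Ioc_mul_eq_sum_sum]
  refine sum_congr rfl ?_
  intro k hk
  rw [mem_Ioc] at hk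
  rw [LL_eq]
  simp [ArithmeticFunction.natCoe_apply, ArithmeticFunction.zeta_apply_ne (show k ≠ 0 by omega)]

/-- Number of entries of `W` dividing `j`. -/
def cnt (W : List ℕ) (j : ℕ) : ℕ := (W.map fun m => if m ∣ j then 1 else 0).sum

/-- Sum of `t / m` over the entries `m` of `W`. -/
def cum (W : List ℕ) (t : ℕ) : ℕ := (W.map fun m => t / m).sum

lemma sum_cnt (W : List ℕ) (t : ℕ) : ∑ j ∈ Ioc 0 t, cnt W j = cum W t := by
  induction W with
  | nil => simp [cnt, cum]
  | cons m W ih =>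
    simp only [cnt, cum, List.map_cons, List.sum_cons, sum_add_distrib] at ih ⊢
    rw [ih]
    congr 1
    rw [sum_boole, Nat.Ioc_filter_dvd_card_eq_div]
    rfl

lemma sum_dvd_LL (x m : ℕ) (hm : 0 < m) :
    ∑ j ∈ Ioc 0 x, (if m ∣ j then LL (x / j) else 0) = Nat.sqrt (x / m) := by
  rw [← sum_LL, ← sum_filter]
  symm
  refine sum_bij (fun k _ => m * k) ?_ ?_ ?_ ?_
  · intro k hk
    rw [mem_Ioc, Nat.le_div_iff_mul_le hm] at hk
    simp only [mem_filter, mem_Ioc, dvd_mul_right, and_true]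
    exact ⟨Nat.mul_pos hm hk.1, by rw [mul_comm]; exact hk.2⟩
  · intro a _ b _ h
    exact Nat.eq_of_mul_eq_mul_left hm h
  · intro b hb
    simp only [mem_filter, mem_Ioc] at hb
    obtain ⟨⟨h1, h2⟩, k, rfl⟩ := hb
    refine ⟨k, ?_, rfl⟩
    rw [mem_Ioc, Nat.le_div_iff_mul_le hm, mul_comm k]
    exact ⟨Nat.pos_of_mul_pos_left h1, h2⟩
  · intro k _
    rw [Nat.div_div_eq_div_mul]

lemma sum_cnt_LL (x : ℕ) (W : List ℕ) (hW : ∀ m ∈ W, 0 < m) :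
    ∑ j ∈ Ioc 0 x, (cnt W j : ℤ) * LL (x / j) = ((W.map fun m => Nat.sqrt (x / m)).sum : ℕ) := by
  induction W with
  | nil => simp [cnt]
  | cons m W ih =>
    have ih := ih (fun a ha => hW a (by simp [ha]))
    simp only [cnt, List.map_cons, List.sum_cons, Nat.cast_add, add_mul, sum_add_distrib] at ih ⊢
    rw [ih, ← sum_dvd_LL x m (hW m (by simp))]
    congr 1
    refine sum_congr rfl ?_
    intro j _
    split_ifs <;> simp

lemma hyper (c : ℕ → ℤ) (x K : ℕ) (hK : 0 < K) :
    ∑ j ∈ Ioc (x / K) x, c j * LL (x / j)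
      = ∑ a ∈ Ico 1 K, liouvilleFn a * ∑ j ∈ Ioc (x / K) (x / a), c j := by
  simp only [LL, mul_sum]
  rw [sum_comm' (t' := Ico 1 K) (s' := fun a => Ioc (x / K) (x / a))]
  · refine sum_congr rfl fun a _ => sum_congr rfl fun j _ => mul_comm _ _
  · intro j a
    simp only [mem_Ioc, mem_Icc, mem_Ico]
    constructor
    · rintro ⟨⟨h1, h2⟩, h3, h4⟩
      have hj : 0 < j := (Nat.zero_le _).trans_lt h1
      rw [Nat.le_div_iff_mul_le hj] at h4
      refine ⟨⟨h1, ?_⟩, h3, ?_⟩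
      · rw [Nat.le_div_iff_mul_le (by omega), mul_comm]; exact h4
      · rw [Nat.div_lt_iff_lt_mul hK] at h1
        by_contra hc
        nlinarith
    · rintro ⟨⟨h1, h2⟩, h3, h4⟩
      have hj : 0 < j := (Nat.zero_le _).trans_lt h1
      refine ⟨⟨h1, h2.trans (Nat.div_le_self _ _)⟩, h3, ?_⟩
      rw [Nat.le_div_iff_mul_le (by omega)] at h2
      rw [Nat.le_div_iff_mul_le hj, mul_comm]; exact h2

/-- The main identity. -/
lemma main_identity (P N : List ℕ) (hP : ∀ m ∈ P, 0 < m) (hN : ∀ m ∈ N, 0 < m) (x K u : ℕ)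
    (hK : 0 < K) (hu : 1 ≤ u) (huJ : u ≤ x / K)
    (h1 : (cnt P 1 : ℤ) - cnt N 1 = 1) (h2 : ∀ j, 2 ≤ j → j ≤ u → (cnt P j : ℤ) - cnt N j = 0) :
    LL x = ((P.map fun m => Nat.sqrt (x / m)).sum : ℕ) - ((N.map fun m => Nat.sqrt (x / m)).sum : ℕ)
      - ∑ j ∈ Ioc u (x / K), ((cnt P j : ℤ) - cnt N j) * LL (x / j)
      - ∑ a ∈ Ico 1 K, liouvilleFn a *
        (((cum P (x / a) : ℤ) - cum N (x / a)) - ((cum P (x / K) : ℤ) - cum N (x / K))) := by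
  have e1 : ∑ j ∈ Ioc 0 x, ((cnt P j : ℤ) - cnt N j) * LL (x / j) =
      ((P.map fun m => Nat.sqrt (x / m)).sum : ℕ) - ((N.map fun m => Nat.sqrt (x / m)).sum : ℕ) := by
    rw [← sum_cnt_LL x P hP, ← sum_cnt_LL x N hN, ← sum_sub_distrib]
    exact sum_congr rfl fun j _ => by ring
  have hJx : x / K ≤ x := Nat.div_le_self _ _
  have e2 : ∑ j ∈ Ioc 0 x, ((cnt P j : ℤ) - cnt N j) * LL (x / j) =
      ∑ j ∈ Ioc 0 u, ((cnt P j : ℤ) - cnt N j) * LL (x / j)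
      + ∑ j ∈ Ioc u (x / K), ((cnt P j : ℤ) - cnt N j) * LL (x / j)
      + ∑ j ∈ Ioc (x / K) x, ((cnt P j : ℤ) - cnt N j) * LL (x / j) := by
    rw [sum_Ioc_consecutive _ (by omega) huJ, sum_Ioc_consecutive _ (by omega) hJx]
  have e3 : ∑ j ∈ Ioc 0 u, ((cnt P j : ℤ) - cnt N j) * LL (x / j) = LL x := by
    rw [sum_eq_single 1]
    · rw [h1]; simp
    · intro b hb hb1
      rw [mem_Ioc] at hb
      rw [h2 b (by omega) (by omega), zero_mul]
    · intro h; exact absurd (mem_Ioc.2 ⟨by omega, hu⟩) h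
  have hc : ∀ (W : List ℕ) (t s : ℕ), s ≤ t → ∑ j ∈ Ioc s t, (cnt W j : ℤ) = (cum W t : ℤ) - cum W s := by
    intro W t s hst
    have := sum_Ioc_consecutive (fun j => (cnt W j : ℤ)) (Nat.zero_le s) hst
    rw [← sum_cnt W t, ← sum_cnt W s]
    push_cast
    linarith
  have e4 := hyper (fun j => (cnt P j : ℤ) - cnt N j) x K hK
  have e5 : ∑ a ∈ Ico 1 K, liouvilleFn a * ∑ j ∈ Ioc (x / K) (x / a), ((cnt P j : ℤ) - cnt N j)
      = ∑ a ∈ Ico 1 K, liouvilleFn a *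
        (((cum P (x / a) : ℤ) - cum N (x / a)) - ((cum P (x / K) : ℤ) - cum N (x / K))) := by
    refine sum_congr rfl ?_
    intro a ha
    rw [mem_Ico] at ha
    have hle : x / K ≤ x / a := Nat.div_le_div_left (by omega) (by omega)
    rw [sum_sub_distrib, hc P _ _ hle, hc N _ _ hle]
    ring
  rw [e5] at e4
  linarith


/-! ### Packed vectors of 16-bit fields -/

/-- The number whose base `65536` digits are `f 0, …, f (C - 1)`. -/
def pack (f : ℕ → ℕ) (C : ℕ) : ℕ := ∑ i ∈ range C, f i * 2 ^ (16 * i)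

lemma pack_add (f g : ℕ → ℕ) (C : ℕ) : pack f C + pack g C = pack (fun i => f i + g i) C := by
  simp only [pack, add_mul, sum_add_distrib]

lemma mul_pack (w : ℕ) (f : ℕ → ℕ) (C : ℕ) : w * pack f C = pack (fun i => w * f i) C := by
  simp only [pack, mul_sum, mul_assoc]

lemma pack_congr {f g : ℕ → ℕ} {C : ℕ} (h : ∀ i < C, f i = g i) : pack f C = pack g C :=
  sum_congr rfl fun i hi => by rw [h i (mem_range.1 hi)]

lemma pack_split (f : ℕ → ℕ) (C D : ℕ) :
    pack f (C + D) = pack f C + 2 ^ (16 * C) * pack (fun i => f (C + i)) D := by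
  simp only [pack, sum_range_add, mul_sum]
  congr 1
  refine sum_congr rfl fun i _ => ?_
  rw [mul_add, pow_add]; ring

lemma pack_lt (f : ℕ → ℕ) (C : ℕ) (h : ∀ i < C, f i < 65536) : pack f C < 2 ^ (16 * C) := by
  induction C with
  | zero => simp [pack]
  | succ C ih =>
    have := ih fun i hi => h i (by omega)
    have hC := h C (by omega)
    rw [pack, sum_range_succ, ← pack, mul_add, pow_add]
    norm_num
    nlinarith [Nat.pos_of_ne_zero (pow_ne_zero (16 * C) (two_ne_zero (α := ℕ)))]

lemma pack_mod (f : ℕ → ℕ) (C k : ℕ) (h : ∀ i < k, f i < 65536) (hk : k ≤ C) :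
    pack f C % 2 ^ (16 * k) = pack f k := by
  obtain ⟨D, rfl⟩ := Nat.exists_eq_add_of_le hk
  rw [pack_split, Nat.add_mul_mod_self_left, Nat.mod_eq_of_lt (pack_lt f k h)]

lemma pack_shift (f : ℕ → ℕ) (C k : ℕ) (h : ∀ i < k, f i < 65536) (hk : k ≤ C) :
    pack f C >>> (16 * k) = pack (fun i => f (k + i)) (C - k) := by
  obtain ⟨D, rfl⟩ := Nat.exists_eq_add_of_le hk
  rw [pack_split, Nat.shiftRight_eq_div_pow, Nat.add_mul_div_left _ _ (by positivity),
    Nat.div_eq_of_lt (pack_lt f k h), zero_add, Nat.add_sub_cancel_left]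

lemma pack_one (f : ℕ → ℕ) : pack f 1 = f 0 := by simp [pack]

lemma pack_digit (f : ℕ → ℕ) (C k : ℕ) (h : ∀ i < C, f i < 65536) (hk : k < C) :
    pack f C >>> (16 * k) % 65536 = f k := by
  rw [pack_shift f C k (fun i hi => h i (by omega)) hk.le]
  have := pack_mod (fun i => f (k + i)) (C - k) 1 (fun i hi => h _ (by omega)) (by omega)
  rw [pack_one] at this
  exact this

lemma pack_digit2 (f : ℕ → ℕ) (C k : ℕ) (h : ∀ i < C, f i < 2) (hk : k < C) :
    pack f C >>> (16 * k) % 2 = f k := by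
  have := pack_digit f C k (fun i hi => (h i hi).trans (by norm_num)) hk
  have h2 := h k hk
  omega

lemma pack_modEq (f : ℕ → ℕ) (C : ℕ) : pack f C ≡ ∑ i ∈ range C, f i [MOD 65535] := by
  have h16 : ∀ i, 2 ^ (16 * i) ≡ 1 [MOD 65535] := by
    intro i
    rw [pow_mul]
    simpa using (show 2 ^ 16 ≡ 1 [MOD 65535] by decide).pow i
  unfold pack
  induction C with
  | zero => rfl
  | succ C ih =>
    rw [sum_range_succ, sum_range_succ]
    simpa using ih.add ((h16 C).mul_left (f C))

lemma pack_mod65535 (f : ℕ → ℕ) (C : ℕ) (h : ∑ i ∈ range C, f i < 65535) :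
    pack f C % 65535 = ∑ i ∈ range C, f i := by
  have := pack_modEq f C
  rw [Nat.ModEq, Nat.mod_eq_of_lt h] at this
  exact this

lemma testBit_pack (f : ℕ → ℕ) (C i b : ℕ) (h : ∀ i < C, f i < 65536) (hb : b < 16) :
    (pack f C).testBit (16 * i + b) = (decide (i < C) && (f i).testBit b) := by
  by_cases hi : i < C
  · have := pack_digit f C i h hi
    simp only [hi, decide_true, Bool.true_and]
    rw [← this, show (65536 : ℕ) = 2 ^ 16 by norm_num, Nat.testBit_mod_two_pow, Nat.testBit_shiftRight]
    simp [hb]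
  · simp only [hi, decide_false, Bool.false_and]
    apply Nat.testBit_lt_two_pow
    exact (pack_lt f C h).trans_le (Nat.pow_le_pow_right (by norm_num) (by omega))

lemma bits_pack (S : ℕ → ℕ) (C t : ℕ) (hS : ∀ i < C, S i < 32768) (ht : t ≤ 32768) :
    ((pack S C + (32768 - t) * pack (fun _ => 1) C) >>> 15 ^^^ pack S C) &&& pack (fun _ => 1) C
      = pack (fun i => if (t ≤ S i ∧ S i % 2 = 0) ∨ (S i < t ∧ S i % 2 = 1) then 1 else 0) C := by
  rw [mul_pack, pack_add]
  apply Nat.eq_of_testBit_eq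
  intro j
  obtain ⟨i, b, hb, rfl⟩ : ∃ i b, b < 16 ∧ j = 16 * i + b :=
    ⟨j / 16, j % 16, Nat.mod_lt _ (by norm_num), (Nat.div_add_mod j 16).symm⟩
  rw [Nat.testBit_and, Nat.testBit_xor, Nat.testBit_shiftRight,
    testBit_pack (fun _ => 1) C i b (fun _ _ => by norm_num) hb,
    testBit_pack S C i b (fun i hi => (hS i hi).trans (by norm_num)) hb,
    testBit_pack _ C i b (fun i hi => by split_ifs <;> norm_num) hb]
  by_cases hi : i < C
  · rcases Nat.eq_zero_or_pos b with rfl | hb0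
    · rw [show 15 + (16 * i + 0) = 16 * i + 15 by ring, testBit_pack _ C i 15 (fun i hi => by have := hS i hi; omega) (by norm_num)]
      have h1 := hS i hi
      simp only [hi, decide_true, Bool.true_and, Nat.testBit_zero]
      have e1 : (S i + (32768 - t) * 1).testBit 15 = decide (t ≤ S i) := by
        rw [Nat.testBit_eq_decide_div_mod_eq]
        by_cases hle : t ≤ S i
        · simp only [hle, decide_true, decide_eq_true_eq]; omega
        · simp only [hle, decide_false, decide_eq_false_iff_not]; omega
      rw [e1]
      by_cases hle : t ≤ S i
      · rcases Nat.mod_two_eq_zero_or_one (S i) with h | h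
        · simp [hle, h]
        · simp [hle, h, not_lt.2 hle]
      · rcases Nat.mod_two_eq_zero_or_one (S i) with h | h
        · simp [hle, h]
        · simp [hle, h, not_le.1 hle]
    · have : ∀ a, a < 2 → Nat.testBit a b = false := fun a ha =>
        Nat.testBit_lt_two_pow (ha.trans_le (by simpa using Nat.pow_le_pow_right (show 0 < 2 by norm_num) hb0))
      rw [this 1 (by norm_num)]
      split_ifs <;> simp [this 1 (by norm_num)]
  · simp [hi]

/-- The multiples of `q`, with weight `w`, in a window starting at `s`. -/
def hit (q w s : ℕ) (i : ℕ) : ℕ := if q ∣ s + i then w else 0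

lemma hit_le (q w s i : ℕ) : hit q w s i ≤ w := by
  unfold hit; split_ifs <;> omega

lemma pack_single (w C i0 : ℕ) (h : i0 < C) :
    pack (fun i => if i = i0 then w else 0) C = w * 2 ^ (16 * i0) := by
  simp [pack, ite_mul, h]

lemma mask_eq (q w T : ℕ) (hq : 0 < q) :
    w * ((2 ^ (16 * (q * T)) - 1) / (2 ^ (16 * q) - 1)) = pack (hit q w 0) (q * T) := by
  have h2 : 2 ≤ 2 ^ (16 * q) := by
    calc 2 = 2 ^ 1 := by norm_num
      _ ≤ _ := Nat.pow_le_pow_right (by norm_num) (by omega)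
  rw [← mul_assoc, pow_mul, ← Nat.geomSum_eq h2]
  induction T with
  | zero => simp [pack]
  | succ T ih =>
    rw [sum_range_succ, mul_add, ih, mul_add, mul_one, pack_split]
    congr 1
    rw [pack_congr (g := fun i => if i = 0 then w else 0), pack_single w q 0 hq]
    · rw [← pow_mul, mul_assoc]; simp [mul_comm]
    · intro i hi
      unfold hit
      simp only [zero_add, Nat.dvd_add_right (dvd_mul_right q T)]
      by_cases h0 : i = 0
      · simp [h0]
      · rw [if_neg h0, if_neg]
        intro hd
        exact absurd (Nat.le_of_dvd (by omega) hd) (by omega)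

lemma small_hit (q w s C : ℕ) (hq : 0 < q) (hw : w < 65536) :
    (w * ((2 ^ (16 * (q * (C / q + 2))) - 1) / (2 ^ (16 * q) - 1))) >>> (16 * (s % q))
      ≡ pack (hit q w s) C [MOD 2 ^ (16 * C)] := by
  have hr : s % q < q := Nat.mod_lt _ hq
  have hC : C < q * (C / q + 1) := Nat.lt_mul_div_succ C hq
  have hb : ∀ s i, hit q w s i < 65536 := fun s i => (hit_le q w s i).trans_lt hw
  have e : q * (C / q + 2) = q * (C / q + 1) + q := by ring
  rw [mask_eq q w _ hq, pack_shift _ _ _ (fun i _ => hb _ i) (by omega)]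
  rw [Nat.ModEq, pack_mod _ _ C (fun i _ => hb _ _) (by omega),
    pack_mod _ _ C (fun i _ => hb _ _) le_rfl]
  refine pack_congr fun i _ => ?_
  unfold hit
  have : q ∣ 0 + (s % q + i) ↔ q ∣ s + i := by
    rw [zero_add]
    conv_rhs => rw [← Nat.div_add_mod s q, add_assoc]
    rw [Nat.dvd_add_right (dvd_mul_right _ _)]
  simp only [this]

lemma big_hit (q w s C : ℕ) (hq : C + 1 ≤ q) :
    w * (2 ^ (16 * (C + 1)) >>> (16 * ((s + C) % q + 1))) = pack (hit q w s) (C + 1) := by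
  have key : ∀ i ≤ C, (q ∣ s + i ↔ (s + C) % q = C - i) := by
    intro i hi
    constructor
    · rintro ⟨k, hk⟩
      rw [show s + C = q * k + (C - i) by omega, Nat.mul_add_mod, Nat.mod_eq_of_lt (by omega)]
    · intro h
      have := Nat.div_add_mod (s + C) q
      exact ⟨(s + C) / q, by omega⟩
  by_cases hr : (s + C) % q ≤ C
  · rw [Nat.shiftRight_eq_div_pow, Nat.pow_div (by omega) (by norm_num),
      pack_congr (g := fun i => if i = C - (s + C) % q then w else 0), pack_single _ _ _ (by omega)]
    · congr 2; omega
    · intro i hi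
      unfold hit
      simp only [key i (by omega)]
      by_cases h : i = C - (s + C) % q
      · rw [if_pos h, if_pos (by omega)]
      · rw [if_neg h, if_neg (by omega)]
  · rw [Nat.shiftRight_eq_div_pow, Nat.div_eq_of_lt (Nat.pow_lt_pow_right (by norm_num) (by omega)), mul_zero]
    rw [pack_congr (g := fun _ => 0)]
    · simp [pack]
    · intro i hi
      unfold hit
      rw [if_neg]
      rw [key i (by omega)]
      omega


/-! ### The weighted sieve -/

/-- The (odd) weight of a prime. -/
def wt (p : ℕ) : ℕ := 2 * Nat.log2 p + 1

lemma wt_upper (p : ℕ) (hp : 2 ≤ p) : p ^ 7 ≤ 2 ^ (4 * wt p) := by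
  by_cases h8 : p < 8
  · unfold wt
    interval_cases p <;> decide
  · have h1 : p < 2 ^ (Nat.log2 p + 1) := Nat.lt_log2_self
    have h3 : 3 ≤ Nat.log2 p := (Nat.le_log2 (by omega)).2 (by omega)
    calc p ^ 7 ≤ (2 ^ (Nat.log2 p + 1)) ^ 7 := Nat.pow_le_pow_left h1.le 7
      _ = 2 ^ ((Nat.log2 p + 1) * 7) := by rw [pow_mul]
      _ ≤ _ := Nat.pow_le_pow_right (by norm_num) (by unfold wt; omega)

lemma wt_lower (p : ℕ) (hp : 2 ≤ p) : 2 ^ wt p ≤ p ^ 3 := by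
  have h1 : 2 ^ Nat.log2 p ≤ p := Nat.log2_self_le (by omega)
  calc 2 ^ wt p = 2 ^ Nat.log2 p * 2 ^ Nat.log2 p * 2 := by unfold wt; ring
    _ ≤ p * p * p := by gcongr
    _ = p ^ 3 := by ring

lemma list_upper (l : List ℕ) (hl : ∀ p ∈ l, 2 ≤ p) : l.prod ^ 7 ≤ 2 ^ (4 * (l.map wt).sum) := by
  induction l with
  | nil => simp
  | cons p l ih =>
    have := ih fun a ha => hl a (by simp [ha])
    have h2 := wt_upper p (hl p (by simp))
    simp only [List.prod_cons, List.map_cons, List.sum_cons, mul_pow, mul_add, pow_add]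
    exact Nat.mul_le_mul h2 this

lemma list_lower (l : List ℕ) (hl : ∀ p ∈ l, 2 ≤ p) : 2 ^ (l.map wt).sum ≤ l.prod ^ 3 := by
  induction l with
  | nil => simp
  | cons p l ih =>
    have := ih fun a ha => hl a (by simp [ha])
    have h2 := wt_lower p (hl p (by simp))
    simp only [List.prod_cons, List.map_cons, List.sum_cons, mul_pow, pow_add]
    exact Nat.mul_le_mul h2 this

lemma list_parity (l : List ℕ) : (l.map wt).sum % 2 = l.length % 2 := by
  induction l with
  | nil => simp
  | cons p l ih =>
    simp only [List.map_cons, List.sum_cons, List.length_cons]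
    unfold wt at *
    omega

/-- Total weight of the prime factors below `2048`. -/
def wsum (n : ℕ) : ℕ := ((n.primeFactorsList.filter (· < 2048)).map wt).sum

lemma neg_one_pow_mod (k : ℕ) : (-1 : ℤ) ^ k = if k % 2 = 0 then 1 else -1 := by
  split_ifs with h
  · exact (Nat.even_iff.2 h).neg_one_pow
  · exact (Nat.odd_iff.2 (by omega)).neg_one_pow

lemma sieve (n t : ℕ) (hn : 1 ≤ n) (hn2 : n < 2 ^ 22)
    (ht : t = (7 * Nat.log2 n + 3) / 4 ∨ (t = 0 ∧ n < 2048)) :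
    liouvilleFn n =
      if (t ≤ wsum n ∧ wsum n % 2 = 0) ∨ (wsum n < t ∧ wsum n % 2 = 1) then 1 else -1 := by
  set l := n.primeFactorsList with hl
  set sm := l.filter (· < 2048) with hsm
  set bg := l.filter (fun p => !decide (p < 2048)) with hbg
  have hperm : (sm ++ bg).Perm l := List.filter_append_perm _ _
  have hlen : sm.length + bg.length = l.length := by
    rw [← List.length_append]; exact hperm.length_eq
  have hprod : sm.prod * bg.prod = n := by
    rw [← List.prod_append, hperm.prod_eq, hl, Nat.prod_primeFactorsList (by omega)]
  have hge : ∀ p ∈ l, 2 ≤ p := fun p hp => (Nat.prime_of_mem_primeFactorsList hp).two_le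
  have hsm2 : ∀ p ∈ sm, 2 ≤ p := fun p hp => hge p (List.mem_of_mem_filter hp)
  have hbg2 : ∀ p ∈ bg, 2048 ≤ p := by
    intro p hp
    have := (List.mem_filter.1 hp).2
    simpa using this
  have hW : wsum n = (sm.map wt).sum := rfl
  have hpar := list_parity sm
  have hup := list_upper sm hsm2
  have hlo := list_lower sm hsm2
  rw [← hW] at hpar hup hlo
  have hk1 : 2 ^ Nat.log2 n ≤ n := Nat.log2_self_le (by omega)
  have hk2 : n < 2 ^ (Nat.log2 n + 1) := Nat.lt_log2_self
  have hk22 : Nat.log2 n < 22 := by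
    rw [← Nat.pow_lt_pow_iff_right (show 1 < 2 by norm_num)]
    omega
  have hsm0 : 0 < sm.prod := Nat.pos_of_ne_zero fun h0 => by rw [h0] at hprod; omega
  have hfn : liouvilleFn n = (-1) ^ l.length := rfl
  rw [hfn, ← hlen, neg_one_pow_mod]
  match hb : bg with
  | [] =>
    simp only [List.prod_nil, mul_one] at hprod
    rw [hprod] at hup
    have : 2 ^ (Nat.log2 n * 7) ≤ 2 ^ (4 * wsum n) := by
      rw [pow_mul]
      exact (Nat.pow_le_pow_left hk1 7).trans hup
    rw [Nat.pow_le_pow_iff_right (by norm_num)] at this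
    simp only [List.length_nil, add_zero]
    congr 1
    rw [eq_iff_iff]
    omega
  | [r] =>
    have hr := hbg2 r (by simp)
    simp only [List.prod_cons, List.prod_nil, mul_one] at hprod
    have hrn : r ≤ n := by
      calc r = 1 * r := (one_mul r).symm
        _ ≤ sm.prod * r := Nat.mul_le_mul_right r hsm0
        _ = n := hprod
    have hk11 : 11 ≤ Nat.log2 n := (Nat.le_log2 (by omega)).2 (by omega)
    obtain ⟨k, hk⟩ := Nat.exists_eq_add_of_le hk11
    have h1 : sm.prod < 2 ^ (k + 1) := by
      by_contra hc
      push Not at hc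
      have : 2 ^ (k + 1) * 2 ^ 11 ≤ sm.prod * r := Nat.mul_le_mul hc (by omega)
      rw [hprod, ← pow_add, show k + 1 + 11 = Nat.log2 n + 1 by omega] at this
      omega
    have h2 : 2 ^ wsum n < 2 ^ ((k + 1) * 3) := by
      rw [pow_mul]
      exact hlo.trans_lt (Nat.pow_lt_pow_left h1 (by norm_num))
    rw [Nat.pow_lt_pow_iff_right (by norm_num)] at h2
    simp only [List.length_cons, List.length_nil, zero_add]
    congr 1
    rw [eq_iff_iff]
    omega
  | r :: r' :: bs =>
    exfalso
    have hr := hbg2 r (by simp)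
    have hr' := hbg2 r' (by simp)
    simp only [List.prod_cons] at hprod
    have hbs : 0 < bs.prod := Nat.pos_of_ne_zero fun h0 => by rw [h0] at hprod; simp at hprod; omega
    have : 1 * (2048 * (2048 * 1)) ≤ sm.prod * (r * (r' * bs.prod)) := by gcongr <;> omega
    rw [hprod] at this
    omega

/-! ### Tables -/

/-- The primes below 2048. -/
def PL : List ℕ := [
   2, 3, 5, 7, 11, 13, 17, 19, 23, 29, 31, 37, 41, 43, 47, 53, 59, 61, 67, 71, 73, 79, 83, 89, 97,
   101, 103, 107, 109, 113, 127, 131, 137, 139, 149, 151, 157, 163, 167, 173, 179, 181, 191, 193,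
   197, 199, 211, 223, 227, 229, 233, 239, 241, 251, 257, 263, 269, 271, 277, 281, 283, 293, 307,
   311, 313, 317, 331, 337, 347, 349, 353, 359, 367, 373, 379, 383, 389, 397, 401, 409, 419, 421,
   431, 433, 439, 443, 449, 457, 461, 463, 467, 479, 487, 491, 499, 503, 509, 521, 523, 541, 547,
   557, 563, 569, 571, 577, 587, 593, 599, 601, 607, 613, 617, 619, 631, 641, 643, 647, 653, 659,
   661, 673, 677, 683, 691, 701, 709, 719, 727, 733, 739, 743, 751, 757, 761, 769, 773, 787, 797,
   809, 811, 821, 823, 827, 829, 839, 853, 857, 859, 863, 877, 881, 883, 887, 907, 911, 919, 929,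
   937, 941, 947, 953, 967, 971, 977, 983, 991, 997, 1009, 1013, 1019, 1021, 1031, 1033, 1039,
   1049, 1051, 1061, 1063, 1069, 1087, 1091, 1093, 1097, 1103, 1109, 1117, 1123, 1129, 1151, 1153,
   1163, 1171, 1181, 1187, 1193, 1201, 1213, 1217, 1223, 1229, 1231, 1237, 1249, 1259, 1277, 1279,
   1283, 1289, 1291, 1297, 1301, 1303, 1307, 1319, 1321, 1327, 1361, 1367, 1373, 1381, 1399, 1409,
   1423, 1427, 1429, 1433, 1439, 1447, 1451, 1453, 1459, 1471, 1481, 1483, 1487, 1489, 1493, 1499,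
   1511, 1523, 1531, 1543, 1549, 1553, 1559, 1567, 1571, 1579, 1583, 1597, 1601, 1607, 1609, 1613,
   1619, 1621, 1627, 1637, 1657, 1663, 1667, 1669, 1693, 1697, 1699, 1709, 1721, 1723, 1733, 1741,
   1747, 1753, 1759, 1777, 1783, 1787, 1789, 1801, 1811, 1823, 1831, 1847, 1861, 1867, 1871, 1873,
   1877, 1879, 1889, 1901, 1907, 1913, 1931, 1933, 1949, 1951, 1973, 1979, 1987, 1993, 1997, 1999,
   2003, 2011, 2017, 2027, 2029, 2039]
/-- Block 0 of prime powers with their weights. -/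
def QS0 : List (ℕ × ℕ) := [
   (2, 3), (4, 3), (8, 3), (16, 3), (32, 3), (64, 3), (128, 3), (256, 3), (512, 3), (1024, 3),
   (2048, 3), (4096, 3), (3, 3), (9, 3), (27, 3), (81, 3), (243, 3), (729, 3), (2187, 3),
   (6561, 3), (5, 5), (25, 5), (125, 5), (625, 5), (3125, 5), (7, 5), (49, 5), (343, 5), (2401, 5),
   (11, 7), (121, 7), (1331, 7), (13, 7), (169, 7), (2197, 7), (17, 9), (289, 9), (4913, 9),
   (19, 9), (361, 9)]
/-- Block 1 of prime powers with their weights. -/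
def QS1 : List (ℕ × ℕ) := [
   (6859, 9), (23, 9), (529, 9), (29, 9), (841, 9), (31, 9), (961, 9), (37, 11), (1369, 11),
   (41, 11), (1681, 11), (43, 11), (1849, 11), (47, 11), (2209, 11), (53, 11), (2809, 11),
   (59, 11), (3481, 11), (61, 11), (3721, 11), (67, 13), (4489, 13), (71, 13), (5041, 13),
   (73, 13), (5329, 13), (79, 13), (6241, 13), (83, 13), (6889, 13), (89, 13), (7921, 13),
   (97, 13), (101, 13), (103, 13), (107, 13), (109, 13), (113, 13), (127, 13)]
/-- Block 2 of prime powers with their weights. -/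
def QS2 : List (ℕ × ℕ) := [
   (131, 15), (137, 15), (139, 15), (149, 15), (151, 15), (157, 15), (163, 15), (167, 15),
   (173, 15), (179, 15), (181, 15), (191, 15), (193, 15), (197, 15), (199, 15), (211, 15),
   (223, 15), (227, 15), (229, 15), (233, 15), (239, 15), (241, 15), (251, 15), (257, 17),
   (263, 17), (269, 17), (271, 17), (277, 17), (281, 17), (283, 17), (293, 17), (307, 17),
   (311, 17), (313, 17), (317, 17), (331, 17), (337, 17), (347, 17), (349, 17), (353, 17)]
/-- Block 3 of prime powers with their weights. -/
def QS3 : List (ℕ × ℕ) := [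
   (359, 17), (367, 17), (373, 17), (379, 17), (383, 17), (389, 17), (397, 17), (401, 17),
   (409, 17), (419, 17), (421, 17), (431, 17), (433, 17), (439, 17), (443, 17), (449, 17),
   (457, 17), (461, 17), (463, 17), (467, 17), (479, 17), (487, 17), (491, 17), (499, 17),
   (503, 17), (509, 17), (521, 19), (523, 19), (541, 19), (547, 19), (557, 19), (563, 19),
   (569, 19), (571, 19), (577, 19), (587, 19), (593, 19), (599, 19), (601, 19), (607, 19)]
/-- Block 4 of prime powers with their weights. -/
def QS4 : List (ℕ × ℕ) := [
   (613, 19), (617, 19), (619, 19), (631, 19), (641, 19), (643, 19), (647, 19), (653, 19),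
   (659, 19), (661, 19), (673, 19), (677, 19), (683, 19), (691, 19), (701, 19), (709, 19),
   (719, 19), (727, 19), (733, 19), (739, 19), (743, 19), (751, 19), (757, 19), (761, 19),
   (769, 19), (773, 19), (787, 19), (797, 19), (809, 19), (811, 19), (821, 19), (823, 19),
   (827, 19), (829, 19), (839, 19), (853, 19), (857, 19), (859, 19), (863, 19), (877, 19)]
/-- Block 5 of prime powers with their weights. -/
def QS5 : List (ℕ × ℕ) := [
   (881, 19), (883, 19), (887, 19), (907, 19), (911, 19), (919, 19), (929, 19), (937, 19),
   (941, 19), (947, 19), (953, 19), (967, 19), (971, 19), (977, 19), (983, 19), (991, 19),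
   (997, 19), (1009, 19), (1013, 19), (1019, 19), (1021, 19), (1031, 21), (1033, 21), (1039, 21),
   (1049, 21), (1051, 21), (1061, 21), (1063, 21), (1069, 21), (1087, 21), (1091, 21), (1093, 21),
   (1097, 21), (1103, 21), (1109, 21), (1117, 21), (1123, 21), (1129, 21), (1151, 21), (1153, 21)]
/-- Block 6 of prime powers with their weights. -/
def QS6 : List (ℕ × ℕ) := [
   (1163, 21), (1171, 21), (1181, 21), (1187, 21), (1193, 21), (1201, 21), (1213, 21), (1217, 21),
   (1223, 21), (1229, 21), (1231, 21), (1237, 21), (1249, 21), (1259, 21), (1277, 21), (1279, 21),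
   (1283, 21), (1289, 21), (1291, 21), (1297, 21), (1301, 21), (1303, 21), (1307, 21), (1319, 21),
   (1321, 21), (1327, 21), (1361, 21), (1367, 21), (1373, 21), (1381, 21), (1399, 21), (1409, 21),
   (1423, 21), (1427, 21), (1429, 21), (1433, 21), (1439, 21), (1447, 21), (1451, 21), (1453, 21)]
/-- Block 7 of prime powers with their weights. -/
def QS7 : List (ℕ × ℕ) := [
   (1459, 21), (1471, 21), (1481, 21), (1483, 21), (1487, 21), (1489, 21), (1493, 21), (1499, 21),
   (1511, 21), (1523, 21), (1531, 21), (1543, 21), (1549, 21), (1553, 21), (1559, 21), (1567, 21),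
   (1571, 21), (1579, 21), (1583, 21), (1597, 21), (1601, 21), (1607, 21), (1609, 21), (1613, 21),
   (1619, 21), (1621, 21), (1627, 21), (1637, 21), (1657, 21), (1663, 21), (1667, 21), (1669, 21),
   (1693, 21), (1697, 21), (1699, 21), (1709, 21), (1721, 21), (1723, 21), (1733, 21), (1741, 21)]
/-- Block 8 of prime powers with their weights. -/
def QS8 : List (ℕ × ℕ) := [
   (1747, 21), (1753, 21), (1759, 21), (1777, 21), (1783, 21), (1787, 21), (1789, 21), (1801, 21),
   (1811, 21), (1823, 21), (1831, 21), (1847, 21), (1861, 21), (1867, 21), (1871, 21), (1873, 21),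
   (1877, 21), (1879, 21), (1889, 21), (1901, 21), (1907, 21), (1913, 21), (1931, 21), (1933, 21),
   (1949, 21), (1951, 21), (1973, 21), (1979, 21), (1987, 21), (1993, 21), (1997, 21), (1999, 21),
   (2003, 21), (2011, 21), (2017, 21), (2027, 21), (2029, 21), (2039, 21)]
def QS : List (ℕ × ℕ) :=
  QS0 ++ (QS1 ++ (QS2 ++ (QS3 ++ (QS4 ++ (QS5 ++ (QS6 ++ (QS7 ++ (QS8 ++ []))))))))
/-- Block 0 of prime powers with their weights. -/
def QB0 : List (ℕ × ℕ) := [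
   (8192, 3), (16384, 3), (32768, 3), (65536, 3), (131072, 3), (262144, 3), (524288, 3),
   (1048576, 3), (2097152, 3), (19683, 3), (59049, 3), (177147, 3), (531441, 3), (1594323, 3),
   (15625, 5), (78125, 5), (390625, 5), (1953125, 5), (16807, 5), (117649, 5), (823543, 5),
   (14641, 7), (161051, 7), (1771561, 7), (28561, 7), (371293, 7), (83521, 9), (1419857, 9),
   (130321, 9), (2476099, 9), (12167, 9), (279841, 9), (24389, 9), (707281, 9), (29791, 9),
   (923521, 9), (50653, 11), (1874161, 11), (68921, 11), (2825761, 11)]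
/-- Block 1 of prime powers with their weights. -/
def QB1 : List (ℕ × ℕ) := [
   (79507, 11), (103823, 11), (148877, 11), (205379, 11), (226981, 11), (300763, 13), (357911, 13),
   (389017, 13), (493039, 13), (571787, 13), (704969, 13), (9409, 13), (912673, 13), (10201, 13),
   (1030301, 13), (10609, 13), (1092727, 13), (11449, 13), (1225043, 13), (11881, 13),
   (1295029, 13), (12769, 13), (1442897, 13), (16129, 13), (2048383, 13), (17161, 15),
   (2248091, 15), (18769, 15), (2571353, 15), (19321, 15), (2685619, 15), (22201, 15), (22801, 15),
   (24649, 15), (26569, 15), (27889, 15), (29929, 15), (32041, 15), (32761, 15), (36481, 15)]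
/-- Block 2 of prime powers with their weights. -/
def QB2 : List (ℕ × ℕ) := [
   (37249, 15), (38809, 15), (39601, 15), (44521, 15), (49729, 15), (51529, 15), (52441, 15),
   (54289, 15), (57121, 15), (58081, 15), (63001, 15), (66049, 17), (69169, 17), (72361, 17),
   (73441, 17), (76729, 17), (78961, 17), (80089, 17), (85849, 17), (94249, 17), (96721, 17),
   (97969, 17), (100489, 17), (109561, 17), (113569, 17), (120409, 17), (121801, 17), (124609, 17),
   (128881, 17), (134689, 17), (139129, 17), (143641, 17), (146689, 17), (151321, 17),
   (157609, 17), (160801, 17), (167281, 17), (175561, 17), (177241, 17), (185761, 17)]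
/-- Block 3 of prime powers with their weights. -/
def QB3 : List (ℕ × ℕ) := [
   (187489, 17), (192721, 17), (196249, 17), (201601, 17), (208849, 17), (212521, 17),
   (214369, 17), (218089, 17), (229441, 17), (237169, 17), (241081, 17), (249001, 17),
   (253009, 17), (259081, 17), (271441, 19), (273529, 19), (292681, 19), (299209, 19),
   (310249, 19), (316969, 19), (323761, 19), (326041, 19), (332929, 19), (344569, 19),
   (351649, 19), (358801, 19), (361201, 19), (368449, 19), (375769, 19), (380689, 19),
   (383161, 19), (398161, 19), (410881, 19), (413449, 19), (418609, 19), (426409, 19),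
   (434281, 19), (436921, 19), (452929, 19), (458329, 19)]
/-- Block 4 of prime powers with their weights. -/
def QB4 : List (ℕ × ℕ) := [
   (466489, 19), (477481, 19), (491401, 19), (502681, 19), (516961, 19), (528529, 19),
   (537289, 19), (546121, 19), (552049, 19), (564001, 19), (573049, 19), (579121, 19),
   (591361, 19), (597529, 19), (619369, 19), (635209, 19), (654481, 19), (657721, 19),
   (674041, 19), (677329, 19), (683929, 19), (687241, 19), (703921, 19), (727609, 19),
   (734449, 19), (737881, 19), (744769, 19), (769129, 19), (776161, 19), (779689, 19),
   (786769, 19), (822649, 19), (829921, 19), (844561, 19), (863041, 19), (877969, 19),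
   (885481, 19), (896809, 19), (908209, 19), (935089, 19)]
/-- Block 5 of prime powers with their weights. -/
def QB5 : List (ℕ × ℕ) := [
   (942841, 19), (954529, 19), (966289, 19), (982081, 19), (994009, 19), (1018081, 19),
   (1026169, 19), (1038361, 19), (1042441, 19), (1062961, 21), (1067089, 21), (1079521, 21),
   (1100401, 21), (1104601, 21), (1125721, 21), (1129969, 21), (1142761, 21), (1181569, 21),
   (1190281, 21), (1194649, 21), (1203409, 21), (1216609, 21), (1229881, 21), (1247689, 21),
   (1261129, 21), (1274641, 21), (1324801, 21), (1329409, 21), (1352569, 21), (1371241, 21),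
   (1394761, 21), (1408969, 21), (1423249, 21), (1442401, 21), (1471369, 21), (1481089, 21),
   (1495729, 21), (1510441, 21), (1515361, 21), (1530169, 21)]
/-- Block 6 of prime powers with their weights. -/
def QB6 : List (ℕ × ℕ) := [
   (1560001, 21), (1585081, 21), (1630729, 21), (1635841, 21), (1646089, 21), (1661521, 21),
   (1666681, 21), (1682209, 21), (1692601, 21), (1697809, 21), (1708249, 21), (1739761, 21),
   (1745041, 21), (1760929, 21), (1852321, 21), (1868689, 21), (1885129, 21), (1907161, 21),
   (1957201, 21), (1985281, 21), (2024929, 21), (2036329, 21), (2042041, 21), (2053489, 21),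
   (2070721, 21), (2093809, 21), (2105401, 21), (2111209, 21), (2128681, 21), (2163841, 21),
   (2193361, 21), (2199289, 21), (2211169, 21), (2217121, 21), (2229049, 21), (2247001, 21),
   (2283121, 21), (2319529, 21), (2343961, 21), (2380849, 21)]
/-- Block 7 of prime powers with their weights. -/
def QB7 : List (ℕ × ℕ) := [
   (2399401, 21), (2411809, 21), (2430481, 21), (2455489, 21), (2468041, 21), (2493241, 21),
   (2505889, 21), (2550409, 21), (2563201, 21), (2582449, 21), (2588881, 21), (2601769, 21),
   (2621161, 21), (2627641, 21), (2647129, 21), (2679769, 21), (2745649, 21), (2765569, 21),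
   (2778889, 21), (2785561, 21), (2866249, 21), (2879809, 21), (2886601, 21), (2920681, 21),
   (2961841, 21), (2968729, 21), (3003289, 21)]
def QB : List (ℕ × ℕ) :=
  QB0 ++ (QB1 ++ (QB2 ++ (QB3 ++ (QB4 ++ (QB5 ++ (QB6 ++ (QB7 ++ [])))))))
/-- Squarefree numbers up to 300 with Möbius value 1. -/
def WP : List ℕ := [
   1, 6, 10, 14, 15, 21, 22, 26, 33, 34, 35, 38, 39, 46, 51, 55, 57, 58, 62, 65, 69, 74, 77, 82,
   85, 86, 87, 91, 93, 94, 95, 106, 111, 115, 118, 119, 122, 123, 129, 133, 134, 141, 142, 143,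
   145, 146, 155, 158, 159, 161, 166, 177, 178, 183, 185, 187, 194, 201, 202, 203, 205, 206, 209,
   210, 213, 214, 215, 217, 218, 219, 221, 226, 235, 237, 247, 249, 253, 254, 259, 262, 265, 267,
   274, 278, 287, 291, 295, 298, 299]
/-- Squarefree numbers up to 300 with Möbius value -1. -/
def WN : List ℕ := [
   2, 3, 5, 7, 11, 13, 17, 19, 23, 29, 30, 31, 37, 41, 42, 43, 47, 53, 59, 61, 66, 67, 70, 71, 73,
   78, 79, 83, 89, 97, 101, 102, 103, 105, 107, 109, 110, 113, 114, 127, 130, 131, 137, 138, 139,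
   149, 151, 154, 157, 163, 165, 167, 170, 173, 174, 179, 181, 182, 186, 190, 191, 193, 195, 197,
   199, 211, 222, 223, 227, 229, 230, 231, 233, 238, 239, 241, 246, 251, 255, 257, 258, 263, 266,
   269, 271, 273, 277, 281, 282, 283, 285, 286, 290, 293]

/-! ### Linking the tables with the sieve -/

/-- A primality test valid below `2048`. -/
def primeB (n : ℕ) : Bool :=
  Nat.ble 2 n && [2, 3, 5, 7, 11, 13, 17, 19, 23, 29, 31, 37, 41, 43].all
    fun p => Nat.beq p n || Nat.blt 0 (n % p)

lemma primeB_iff (n : ℕ) (hn : n < 2048) : primeB n = true ↔ n.Prime := by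
  have hb : primeB n = true ↔
      2 ≤ n ∧ ∀ p ∈ [2, 3, 5, 7, 11, 13, 17, 19, 23, 29, 31, 37, 41, 43], p = n ∨ 0 < n % p := by
    simp only [primeB, Bool.and_eq_true, Nat.ble_eq, List.all_eq_true, Bool.or_eq_true, Nat.beq_eq,
      Nat.blt_eq]
  rw [hb]
  constructor
  · rintro ⟨h2, h⟩
    by_contra hp
    have h3 : n.minFac ^ 2 ≤ n := Nat.minFac_sq_le_self (by omega) hp
    have h4 : n.minFac.Prime := Nat.minFac_prime (by omega)
    have h5 : n.minFac ∣ n := Nat.minFac_dvd n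
    have h6 : n.minFac < 46 := by nlinarith
    generalize n.minFac = m at *
    have h7 : m ∈ [2, 3, 5, 7, 11, 13, 17, 19, 23, 29, 31, 37, 41, 43] := by
      clear hb h h2 h3 h5 hn hp
      interval_cases m <;> first | decide | (exfalso; revert h4; norm_num)
    rcases h m h7 with h8 | h8
    · exact hp (h8 ▸ h4)
    · rw [Nat.mod_eq_zero_of_dvd h5] at h8
      exact absurd h8 (lt_irrefl 0)
  · intro hp
    refine ⟨hp.two_le, ?_⟩
    intro p hpm
    by_contra hc
    push Not at hc
    have h0 : n % p = 0 := by omega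
    rcases (Nat.dvd_prime hp).1 (Nat.dvd_of_mod_eq_zero h0) with h | h
    · subst h; revert hpm; decide
    · exact hc.1 h

set_option linter.defProp false in
def PL_check : PL = (List.range 2048).filter primeB := by decide +kernel

lemma mem_PL (p : ℕ) : p ∈ PL ↔ p.Prime ∧ p < 2048 := by
  rw [PL_check, List.mem_filter, List.mem_range]
  constructor
  · rintro ⟨h1, h2⟩; exact ⟨(primeB_iff p h1).1 h2, h1⟩
  · rintro ⟨h1, h2⟩; exact ⟨h2, (primeB_iff p h2).2 h1⟩

lemma PL_nodup : PL.Nodup := by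
  rw [PL_check]; exact List.nodup_range.filter _

/-- All prime powers with exponent at most 21. -/
def allQ : List (ℕ × ℕ) := PL.flatMap fun p => (List.range 21).map fun e => (p ^ (e + 1), wt p)

set_option linter.defProp false in
def QS_check : QS = allQ.filter (fun p => Nat.blt p.1 8192) := by decide +kernel
set_option linter.defProp false in
def QB_check : QB = allQ.filter (fun p => !Nat.blt p.1 8192 && Nat.blt p.1 3014656) := by
  decide +kernel

/-- Total weight of the entries of `Q` dividing `n`. -/
def qsum (Q : List (ℕ × ℕ)) (n : ℕ) : ℕ := (Q.map fun p => if p.1 ∣ n then p.2 else 0).sum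

lemma qsum_filter (Q : List (ℕ × ℕ)) (n : ℕ) (hn : 1 ≤ n) (hn2 : n < 3014656) :
    qsum (Q.filter (fun p => Nat.blt p.1 8192)) n
      + qsum (Q.filter (fun p => !Nat.blt p.1 8192 && Nat.blt p.1 3014656)) n = qsum Q n := by
  induction Q with
  | nil => rfl
  | cons p Q ih =>
    unfold qsum at *
    by_cases h1 : p.1 < 8192
    · have e1 : Nat.blt p.1 8192 = true := by simpa using h1
      simp only [List.filter_cons, e1, if_true, List.map_cons, List.sum_cons, Bool.not_true,
        Bool.false_and]
      rw [← ih]; simp only [Bool.false_eq_true, if_false]; ring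
    · have e1 : Nat.blt p.1 8192 = false := by
        rw [← Bool.not_eq_true, Nat.blt_eq]; exact h1
      by_cases h2 : p.1 < 3014656
      · have e2 : Nat.blt p.1 3014656 = true := by simpa using h2
        simp only [List.filter_cons, e1, e2, if_true, List.map_cons, List.sum_cons, Bool.not_false,
          Bool.true_and]
        rw [← ih]; simp only [Bool.false_eq_true, if_false]; ring
      · have e2 : Nat.blt p.1 3014656 = false := by
          rw [← Bool.not_eq_true, Nat.blt_eq]; exact h2
        have h3 : ¬ p.1 ∣ n := fun hd => by have := Nat.le_of_dvd (by omega) hd; omega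
        simp only [List.filter_cons, e1, e2, List.map_cons, List.sum_cons, Bool.and_false, h3,
          if_false, zero_add]
        rw [← ih]; simp only [Bool.false_eq_true, if_false]

lemma sum_pow_hits_aux (p n w N : ℕ) (hp : p.Prime) (hn : 1 ≤ n) (hv : n.factorization p ≤ N) :
    ((List.range N).map fun e => if p ^ (e + 1) ∣ n then w else 0).sum
      = n.primeFactorsList.count p * w := by
  rw [Nat.primeFactorsList_count_eq]
  have e1 : ∀ f : ℕ → ℕ, ((List.range N).map f).sum = ∑ e ∈ range N, f e := by
    intro f
    rw [← List.sum_toFinset f List.nodup_range, List.toFinset_range]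
  rw [e1, ← sum_filter, sum_const, smul_eq_mul]
  congr 1
  have : filter (fun e => p ^ (e + 1) ∣ n) (range N) = range (n.factorization p) := by
    ext e
    simp only [mem_filter, mem_range, hp.pow_dvd_iff_le_factorization (show n ≠ 0 by omega)]
    omega
  rw [this, card_range]

lemma factorization_le (p n : ℕ) (hp : p.Prime) (hn : 1 ≤ n) (hn2 : n < 2 ^ 22) :
    n.factorization p ≤ 21 := by
  by_contra hc
  have h1 : p ^ 22 ∣ n := (hp.pow_dvd_iff_le_factorization (by omega)).2 (by omega)
  have h2 := Nat.le_of_dvd (by omega) h1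
  have h3 : 2 ^ 22 ≤ p ^ 22 := Nat.pow_le_pow_left hp.two_le 22
  exact absurd (h3.trans h2) (not_le.2 hn2)

lemma sum_pow_hits (p n w : ℕ) (hp : p.Prime) (hn : 1 ≤ n) (hn2 : n < 2 ^ 22) :
    ((List.range 21).map fun e => if p ^ (e + 1) ∣ n then w else 0).sum
      = n.primeFactorsList.count p * w :=
  sum_pow_hits_aux p n w 21 hp hn (factorization_le p n hp hn hn2)

lemma sum_map_filter_wt (l : List ℕ) (hl : ∀ p ∈ l, p.Prime) :
    ((l.filter (· < 2048)).map wt).sum = ∑ p ∈ PL.toFinset, l.count p * wt p := by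
  induction l with
  | nil => simp
  | cons a l ih =>
    have ih := ih fun p hp => hl p (by simp [hp])
    have ha := hl a (by simp)
    have e : ∀ p, (a :: l).count p * wt p = l.count p * wt p + if a = p then wt p else 0 := by
      intro p
      rw [List.count_cons, add_mul]
      by_cases h : a = p <;> simp [h]
    simp only [e]
    rw [sum_add_distrib, ← ih, sum_ite_eq, List.filter_cons]
    simp only [List.mem_toFinset, mem_PL, ha, true_and]
    by_cases h : a < 2048
    · simp [h, add_comm]
    · simp [h]

lemma qsum_allQ (n : ℕ) (hn : 1 ≤ n) (hn2 : n < 2 ^ 22) : qsum allQ n = wsum n := by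
  unfold wsum
  rw [sum_map_filter_wt _ fun p hp => Nat.prime_of_mem_primeFactorsList hp,
    List.sum_toFinset _ PL_nodup]
  have : ∀ l : List ℕ, (∀ p ∈ l, p.Prime) →
      qsum (l.flatMap fun p => (List.range 21).map fun e => (p ^ (e + 1), wt p)) n
        = (l.map fun p => n.primeFactorsList.count p * wt p).sum := by
    intro l hl
    induction l with
    | nil => rfl
    | cons p l ih =>
      have ih := ih fun q hq => hl q (by simp [hq])
      unfold qsum at *
      rw [List.flatMap_cons, List.map_append, List.sum_append, ih, List.map_cons, List.sum_cons,
        ← sum_pow_hits p n (wt p) (hl p (by simp)) hn hn2, List.map_map]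
      rfl
  exact this PL fun p hp => ((mem_PL p).1 hp).1

lemma wsum_eq (n : ℕ) (hn : 1 ≤ n) (hn2 : n < 3014656) : qsum QS n + qsum QB n = wsum n := by
  rw [QS_check, QB_check, qsum_filter _ n hn hn2, qsum_allQ n hn (by omega)]

/-! ### The kernel computation -/


/-- Evaluate `x` to a literal before handing it to the continuation `k`. -/
def force (x : Nat) (k : Nat → Nat) : Nat :=
  Nat.rec (motive := fun _ => Nat) (k (nat_lit 0)) (fun n _ => k n) (Nat.add x (nat_lit 1))

/-- `∑_{t < 8192/q + 2} w * 2^(16 q t)` -/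
def maskOf (q w : Nat) : Nat :=
  Nat.mul w (Nat.div (Nat.sub (Nat.pow (nat_lit 2) (Nat.mul (nat_lit 16)
    (Nat.mul q (Nat.add (Nat.div (nat_lit 8192) q) (nat_lit 2))))) (nat_lit 1))
    (Nat.sub (Nat.pow (nat_lit 2) (Nat.mul (nat_lit 16) q)) (nat_lit 1)))

infixr:65 "⊹" => Nat.add
notation "mS(" q "," w "," s ")" => Nat.shiftRight (maskOf q w) (Nat.mul (nat_lit 16) (Nat.mod s q))
notation "mB(" q "," w "," e ")" => Nat.mul w (Nat.shiftRight (Nat.pow (nat_lit 2) (nat_lit 131072)) (Nat.mul (nat_lit 16) (Nat.add (Nat.mod e q) (nat_lit 1))))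
notation "mD(" q "," t ")" => Nat.div t q

def fS0 (s : Nat) : Nat :=
    mS(2,3,s)⊹ mS(4,3,s)⊹ mS(8,3,s)⊹ mS(16,3,s)⊹ mS(32,3,s)⊹ mS(64,3,s)⊹ mS(128,3,s)⊹ mS(256,3,s)⊹
    mS(512,3,s)⊹ mS(1024,3,s)⊹ mS(2048,3,s)⊹ mS(4096,3,s)⊹ mS(3,3,s)⊹ mS(9,3,s)⊹ mS(27,3,s)⊹
    mS(81,3,s)⊹ mS(243,3,s)⊹ mS(729,3,s)⊹ mS(2187,3,s)⊹ mS(6561,3,s)⊹ mS(5,5,s)⊹ mS(25,5,s)⊹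
    mS(125,5,s)⊹ mS(625,5,s)⊹ mS(3125,5,s)⊹ mS(7,5,s)⊹ mS(49,5,s)⊹ mS(343,5,s)⊹ mS(2401,5,s)⊹
    mS(11,7,s)⊹ mS(121,7,s)⊹ mS(1331,7,s)⊹ mS(13,7,s)⊹ mS(169,7,s)⊹ mS(2197,7,s)⊹ mS(17,9,s)⊹
    mS(289,9,s)⊹ mS(4913,9,s)⊹ mS(19,9,s)⊹ mS(361,9,s)⊹ 0
def fS1 (s : Nat) : Nat :=
    mS(6859,9,s)⊹ mS(23,9,s)⊹ mS(529,9,s)⊹ mS(29,9,s)⊹ mS(841,9,s)⊹ mS(31,9,s)⊹ mS(961,9,s)⊹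
    mS(37,11,s)⊹ mS(1369,11,s)⊹ mS(41,11,s)⊹ mS(1681,11,s)⊹ mS(43,11,s)⊹ mS(1849,11,s)⊹
    mS(47,11,s)⊹ mS(2209,11,s)⊹ mS(53,11,s)⊹ mS(2809,11,s)⊹ mS(59,11,s)⊹ mS(3481,11,s)⊹
    mS(61,11,s)⊹ mS(3721,11,s)⊹ mS(67,13,s)⊹ mS(4489,13,s)⊹ mS(71,13,s)⊹ mS(5041,13,s)⊹
    mS(73,13,s)⊹ mS(5329,13,s)⊹ mS(79,13,s)⊹ mS(6241,13,s)⊹ mS(83,13,s)⊹ mS(6889,13,s)⊹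
    mS(89,13,s)⊹ mS(7921,13,s)⊹ mS(97,13,s)⊹ mS(101,13,s)⊹ mS(103,13,s)⊹ mS(107,13,s)⊹
    mS(109,13,s)⊹ mS(113,13,s)⊹ mS(127,13,s)⊹ 0
def fS2 (s : Nat) : Nat :=
    mS(131,15,s)⊹ mS(137,15,s)⊹ mS(139,15,s)⊹ mS(149,15,s)⊹ mS(151,15,s)⊹ mS(157,15,s)⊹
    mS(163,15,s)⊹ mS(167,15,s)⊹ mS(173,15,s)⊹ mS(179,15,s)⊹ mS(181,15,s)⊹ mS(191,15,s)⊹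
    mS(193,15,s)⊹ mS(197,15,s)⊹ mS(199,15,s)⊹ mS(211,15,s)⊹ mS(223,15,s)⊹ mS(227,15,s)⊹
    mS(229,15,s)⊹ mS(233,15,s)⊹ mS(239,15,s)⊹ mS(241,15,s)⊹ mS(251,15,s)⊹ mS(257,17,s)⊹
    mS(263,17,s)⊹ mS(269,17,s)⊹ mS(271,17,s)⊹ mS(277,17,s)⊹ mS(281,17,s)⊹ mS(283,17,s)⊹
    mS(293,17,s)⊹ mS(307,17,s)⊹ mS(311,17,s)⊹ mS(313,17,s)⊹ mS(317,17,s)⊹ mS(331,17,s)⊹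
    mS(337,17,s)⊹ mS(347,17,s)⊹ mS(349,17,s)⊹ mS(353,17,s)⊹ 0
def fS3 (s : Nat) : Nat :=
    mS(359,17,s)⊹ mS(367,17,s)⊹ mS(373,17,s)⊹ mS(379,17,s)⊹ mS(383,17,s)⊹ mS(389,17,s)⊹
    mS(397,17,s)⊹ mS(401,17,s)⊹ mS(409,17,s)⊹ mS(419,17,s)⊹ mS(421,17,s)⊹ mS(431,17,s)⊹
    mS(433,17,s)⊹ mS(439,17,s)⊹ mS(443,17,s)⊹ mS(449,17,s)⊹ mS(457,17,s)⊹ mS(461,17,s)⊹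
    mS(463,17,s)⊹ mS(467,17,s)⊹ mS(479,17,s)⊹ mS(487,17,s)⊹ mS(491,17,s)⊹ mS(499,17,s)⊹
    mS(503,17,s)⊹ mS(509,17,s)⊹ mS(521,19,s)⊹ mS(523,19,s)⊹ mS(541,19,s)⊹ mS(547,19,s)⊹
    mS(557,19,s)⊹ mS(563,19,s)⊹ mS(569,19,s)⊹ mS(571,19,s)⊹ mS(577,19,s)⊹ mS(587,19,s)⊹
    mS(593,19,s)⊹ mS(599,19,s)⊹ mS(601,19,s)⊹ mS(607,19,s)⊹ 0
def fS4 (s : Nat) : Nat :=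
    mS(613,19,s)⊹ mS(617,19,s)⊹ mS(619,19,s)⊹ mS(631,19,s)⊹ mS(641,19,s)⊹ mS(643,19,s)⊹
    mS(647,19,s)⊹ mS(653,19,s)⊹ mS(659,19,s)⊹ mS(661,19,s)⊹ mS(673,19,s)⊹ mS(677,19,s)⊹
    mS(683,19,s)⊹ mS(691,19,s)⊹ mS(701,19,s)⊹ mS(709,19,s)⊹ mS(719,19,s)⊹ mS(727,19,s)⊹
    mS(733,19,s)⊹ mS(739,19,s)⊹ mS(743,19,s)⊹ mS(751,19,s)⊹ mS(757,19,s)⊹ mS(761,19,s)⊹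
    mS(769,19,s)⊹ mS(773,19,s)⊹ mS(787,19,s)⊹ mS(797,19,s)⊹ mS(809,19,s)⊹ mS(811,19,s)⊹
    mS(821,19,s)⊹ mS(823,19,s)⊹ mS(827,19,s)⊹ mS(829,19,s)⊹ mS(839,19,s)⊹ mS(853,19,s)⊹
    mS(857,19,s)⊹ mS(859,19,s)⊹ mS(863,19,s)⊹ mS(877,19,s)⊹ 0
def fS5 (s : Nat) : Nat :=
    mS(881,19,s)⊹ mS(883,19,s)⊹ mS(887,19,s)⊹ mS(907,19,s)⊹ mS(911,19,s)⊹ mS(919,19,s)⊹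
    mS(929,19,s)⊹ mS(937,19,s)⊹ mS(941,19,s)⊹ mS(947,19,s)⊹ mS(953,19,s)⊹ mS(967,19,s)⊹
    mS(971,19,s)⊹ mS(977,19,s)⊹ mS(983,19,s)⊹ mS(991,19,s)⊹ mS(997,19,s)⊹ mS(1009,19,s)⊹
    mS(1013,19,s)⊹ mS(1019,19,s)⊹ mS(1021,19,s)⊹ mS(1031,21,s)⊹ mS(1033,21,s)⊹ mS(1039,21,s)⊹
    mS(1049,21,s)⊹ mS(1051,21,s)⊹ mS(1061,21,s)⊹ mS(1063,21,s)⊹ mS(1069,21,s)⊹ mS(1087,21,s)⊹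
    mS(1091,21,s)⊹ mS(1093,21,s)⊹ mS(1097,21,s)⊹ mS(1103,21,s)⊹ mS(1109,21,s)⊹ mS(1117,21,s)⊹
    mS(1123,21,s)⊹ mS(1129,21,s)⊹ mS(1151,21,s)⊹ mS(1153,21,s)⊹ 0
def fS6 (s : Nat) : Nat :=
    mS(1163,21,s)⊹ mS(1171,21,s)⊹ mS(1181,21,s)⊹ mS(1187,21,s)⊹ mS(1193,21,s)⊹ mS(1201,21,s)⊹
    mS(1213,21,s)⊹ mS(1217,21,s)⊹ mS(1223,21,s)⊹ mS(1229,21,s)⊹ mS(1231,21,s)⊹ mS(1237,21,s)⊹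
    mS(1249,21,s)⊹ mS(1259,21,s)⊹ mS(1277,21,s)⊹ mS(1279,21,s)⊹ mS(1283,21,s)⊹ mS(1289,21,s)⊹
    mS(1291,21,s)⊹ mS(1297,21,s)⊹ mS(1301,21,s)⊹ mS(1303,21,s)⊹ mS(1307,21,s)⊹ mS(1319,21,s)⊹
    mS(1321,21,s)⊹ mS(1327,21,s)⊹ mS(1361,21,s)⊹ mS(1367,21,s)⊹ mS(1373,21,s)⊹ mS(1381,21,s)⊹
    mS(1399,21,s)⊹ mS(1409,21,s)⊹ mS(1423,21,s)⊹ mS(1427,21,s)⊹ mS(1429,21,s)⊹ mS(1433,21,s)⊹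
    mS(1439,21,s)⊹ mS(1447,21,s)⊹ mS(1451,21,s)⊹ mS(1453,21,s)⊹ 0
def fS7 (s : Nat) : Nat :=
    mS(1459,21,s)⊹ mS(1471,21,s)⊹ mS(1481,21,s)⊹ mS(1483,21,s)⊹ mS(1487,21,s)⊹ mS(1489,21,s)⊹
    mS(1493,21,s)⊹ mS(1499,21,s)⊹ mS(1511,21,s)⊹ mS(1523,21,s)⊹ mS(1531,21,s)⊹ mS(1543,21,s)⊹
    mS(1549,21,s)⊹ mS(1553,21,s)⊹ mS(1559,21,s)⊹ mS(1567,21,s)⊹ mS(1571,21,s)⊹ mS(1579,21,s)⊹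
    mS(1583,21,s)⊹ mS(1597,21,s)⊹ mS(1601,21,s)⊹ mS(1607,21,s)⊹ mS(1609,21,s)⊹ mS(1613,21,s)⊹
    mS(1619,21,s)⊹ mS(1621,21,s)⊹ mS(1627,21,s)⊹ mS(1637,21,s)⊹ mS(1657,21,s)⊹ mS(1663,21,s)⊹
    mS(1667,21,s)⊹ mS(1669,21,s)⊹ mS(1693,21,s)⊹ mS(1697,21,s)⊹ mS(1699,21,s)⊹ mS(1709,21,s)⊹
    mS(1721,21,s)⊹ mS(1723,21,s)⊹ mS(1733,21,s)⊹ mS(1741,21,s)⊹ 0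
def fS8 (s : Nat) : Nat :=
    mS(1747,21,s)⊹ mS(1753,21,s)⊹ mS(1759,21,s)⊹ mS(1777,21,s)⊹ mS(1783,21,s)⊹ mS(1787,21,s)⊹
    mS(1789,21,s)⊹ mS(1801,21,s)⊹ mS(1811,21,s)⊹ mS(1823,21,s)⊹ mS(1831,21,s)⊹ mS(1847,21,s)⊹
    mS(1861,21,s)⊹ mS(1867,21,s)⊹ mS(1871,21,s)⊹ mS(1873,21,s)⊹ mS(1877,21,s)⊹ mS(1879,21,s)⊹
    mS(1889,21,s)⊹ mS(1901,21,s)⊹ mS(1907,21,s)⊹ mS(1913,21,s)⊹ mS(1931,21,s)⊹ mS(1933,21,s)⊹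
    mS(1949,21,s)⊹ mS(1951,21,s)⊹ mS(1973,21,s)⊹ mS(1979,21,s)⊹ mS(1987,21,s)⊹ mS(1993,21,s)⊹
    mS(1997,21,s)⊹ mS(1999,21,s)⊹ mS(2003,21,s)⊹ mS(2011,21,s)⊹ mS(2017,21,s)⊹ mS(2027,21,s)⊹
    mS(2029,21,s)⊹ mS(2039,21,s)⊹ 0
def fS (s : Nat) : Nat :=
    fS0 s⊹ fS1 s⊹ fS2 s⊹ fS3 s⊹ fS4 s⊹ fS5 s⊹ fS6 s⊹ fS7 s⊹ fS8 s⊹ 0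

def fB0 (e : Nat) : Nat :=
    mB(8192,3,e)⊹ mB(16384,3,e)⊹ mB(32768,3,e)⊹ mB(65536,3,e)⊹ mB(131072,3,e)⊹ mB(262144,3,e)⊹
    mB(524288,3,e)⊹ mB(1048576,3,e)⊹ mB(2097152,3,e)⊹ mB(19683,3,e)⊹ mB(59049,3,e)⊹ mB(177147,3,e)⊹
    mB(531441,3,e)⊹ mB(1594323,3,e)⊹ mB(15625,5,e)⊹ mB(78125,5,e)⊹ mB(390625,5,e)⊹ mB(1953125,5,e)⊹
    mB(16807,5,e)⊹ mB(117649,5,e)⊹ mB(823543,5,e)⊹ mB(14641,7,e)⊹ mB(161051,7,e)⊹ mB(1771561,7,e)⊹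
    mB(28561,7,e)⊹ mB(371293,7,e)⊹ mB(83521,9,e)⊹ mB(1419857,9,e)⊹ mB(130321,9,e)⊹ mB(2476099,9,e)⊹
    mB(12167,9,e)⊹ mB(279841,9,e)⊹ mB(24389,9,e)⊹ mB(707281,9,e)⊹ mB(29791,9,e)⊹ mB(923521,9,e)⊹
    mB(50653,11,e)⊹ mB(1874161,11,e)⊹ mB(68921,11,e)⊹ mB(2825761,11,e)⊹ 0
def fB1 (e : Nat) : Nat :=
    mB(79507,11,e)⊹ mB(103823,11,e)⊹ mB(148877,11,e)⊹ mB(205379,11,e)⊹ mB(226981,11,e)⊹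
    mB(300763,13,e)⊹ mB(357911,13,e)⊹ mB(389017,13,e)⊹ mB(493039,13,e)⊹ mB(571787,13,e)⊹
    mB(704969,13,e)⊹ mB(9409,13,e)⊹ mB(912673,13,e)⊹ mB(10201,13,e)⊹ mB(1030301,13,e)⊹
    mB(10609,13,e)⊹ mB(1092727,13,e)⊹ mB(11449,13,e)⊹ mB(1225043,13,e)⊹ mB(11881,13,e)⊹
    mB(1295029,13,e)⊹ mB(12769,13,e)⊹ mB(1442897,13,e)⊹ mB(16129,13,e)⊹ mB(2048383,13,e)⊹
    mB(17161,15,e)⊹ mB(2248091,15,e)⊹ mB(18769,15,e)⊹ mB(2571353,15,e)⊹ mB(19321,15,e)⊹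
    mB(2685619,15,e)⊹ mB(22201,15,e)⊹ mB(22801,15,e)⊹ mB(24649,15,e)⊹ mB(26569,15,e)⊹
    mB(27889,15,e)⊹ mB(29929,15,e)⊹ mB(32041,15,e)⊹ mB(32761,15,e)⊹ mB(36481,15,e)⊹ 0
def fB2 (e : Nat) : Nat :=
    mB(37249,15,e)⊹ mB(38809,15,e)⊹ mB(39601,15,e)⊹ mB(44521,15,e)⊹ mB(49729,15,e)⊹ mB(51529,15,e)⊹
    mB(52441,15,e)⊹ mB(54289,15,e)⊹ mB(57121,15,e)⊹ mB(58081,15,e)⊹ mB(63001,15,e)⊹ mB(66049,17,e)⊹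
    mB(69169,17,e)⊹ mB(72361,17,e)⊹ mB(73441,17,e)⊹ mB(76729,17,e)⊹ mB(78961,17,e)⊹ mB(80089,17,e)⊹
    mB(85849,17,e)⊹ mB(94249,17,e)⊹ mB(96721,17,e)⊹ mB(97969,17,e)⊹ mB(100489,17,e)⊹
    mB(109561,17,e)⊹ mB(113569,17,e)⊹ mB(120409,17,e)⊹ mB(121801,17,e)⊹ mB(124609,17,e)⊹
    mB(128881,17,e)⊹ mB(134689,17,e)⊹ mB(139129,17,e)⊹ mB(143641,17,e)⊹ mB(146689,17,e)⊹
    mB(151321,17,e)⊹ mB(157609,17,e)⊹ mB(160801,17,e)⊹ mB(167281,17,e)⊹ mB(175561,17,e)⊹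
    mB(177241,17,e)⊹ mB(185761,17,e)⊹ 0
def fB3 (e : Nat) : Nat :=
    mB(187489,17,e)⊹ mB(192721,17,e)⊹ mB(196249,17,e)⊹ mB(201601,17,e)⊹ mB(208849,17,e)⊹
    mB(212521,17,e)⊹ mB(214369,17,e)⊹ mB(218089,17,e)⊹ mB(229441,17,e)⊹ mB(237169,17,e)⊹
    mB(241081,17,e)⊹ mB(249001,17,e)⊹ mB(253009,17,e)⊹ mB(259081,17,e)⊹ mB(271441,19,e)⊹
    mB(273529,19,e)⊹ mB(292681,19,e)⊹ mB(299209,19,e)⊹ mB(310249,19,e)⊹ mB(316969,19,e)⊹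
    mB(323761,19,e)⊹ mB(326041,19,e)⊹ mB(332929,19,e)⊹ mB(344569,19,e)⊹ mB(351649,19,e)⊹
    mB(358801,19,e)⊹ mB(361201,19,e)⊹ mB(368449,19,e)⊹ mB(375769,19,e)⊹ mB(380689,19,e)⊹
    mB(383161,19,e)⊹ mB(398161,19,e)⊹ mB(410881,19,e)⊹ mB(413449,19,e)⊹ mB(418609,19,e)⊹
    mB(426409,19,e)⊹ mB(434281,19,e)⊹ mB(436921,19,e)⊹ mB(452929,19,e)⊹ mB(458329,19,e)⊹ 0
def fB4 (e : Nat) : Nat :=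
    mB(466489,19,e)⊹ mB(477481,19,e)⊹ mB(491401,19,e)⊹ mB(502681,19,e)⊹ mB(516961,19,e)⊹
    mB(528529,19,e)⊹ mB(537289,19,e)⊹ mB(546121,19,e)⊹ mB(552049,19,e)⊹ mB(564001,19,e)⊹
    mB(573049,19,e)⊹ mB(579121,19,e)⊹ mB(591361,19,e)⊹ mB(597529,19,e)⊹ mB(619369,19,e)⊹
    mB(635209,19,e)⊹ mB(654481,19,e)⊹ mB(657721,19,e)⊹ mB(674041,19,e)⊹ mB(677329,19,e)⊹
    mB(683929,19,e)⊹ mB(687241,19,e)⊹ mB(703921,19,e)⊹ mB(727609,19,e)⊹ mB(734449,19,e)⊹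
    mB(737881,19,e)⊹ mB(744769,19,e)⊹ mB(769129,19,e)⊹ mB(776161,19,e)⊹ mB(779689,19,e)⊹
    mB(786769,19,e)⊹ mB(822649,19,e)⊹ mB(829921,19,e)⊹ mB(844561,19,e)⊹ mB(863041,19,e)⊹
    mB(877969,19,e)⊹ mB(885481,19,e)⊹ mB(896809,19,e)⊹ mB(908209,19,e)⊹ mB(935089,19,e)⊹ 0
def fB5 (e : Nat) : Nat :=
    mB(942841,19,e)⊹ mB(954529,19,e)⊹ mB(966289,19,e)⊹ mB(982081,19,e)⊹ mB(994009,19,e)⊹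
    mB(1018081,19,e)⊹ mB(1026169,19,e)⊹ mB(1038361,19,e)⊹ mB(1042441,19,e)⊹ mB(1062961,21,e)⊹
    mB(1067089,21,e)⊹ mB(1079521,21,e)⊹ mB(1100401,21,e)⊹ mB(1104601,21,e)⊹ mB(1125721,21,e)⊹
    mB(1129969,21,e)⊹ mB(1142761,21,e)⊹ mB(1181569,21,e)⊹ mB(1190281,21,e)⊹ mB(1194649,21,e)⊹
    mB(1203409,21,e)⊹ mB(1216609,21,e)⊹ mB(1229881,21,e)⊹ mB(1247689,21,e)⊹ mB(1261129,21,e)⊹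
    mB(1274641,21,e)⊹ mB(1324801,21,e)⊹ mB(1329409,21,e)⊹ mB(1352569,21,e)⊹ mB(1371241,21,e)⊹
    mB(1394761,21,e)⊹ mB(1408969,21,e)⊹ mB(1423249,21,e)⊹ mB(1442401,21,e)⊹ mB(1471369,21,e)⊹
    mB(1481089,21,e)⊹ mB(1495729,21,e)⊹ mB(1510441,21,e)⊹ mB(1515361,21,e)⊹ mB(1530169,21,e)⊹ 0
def fB6 (e : Nat) : Nat :=
    mB(1560001,21,e)⊹ mB(1585081,21,e)⊹ mB(1630729,21,e)⊹ mB(1635841,21,e)⊹ mB(1646089,21,e)⊹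
    mB(1661521,21,e)⊹ mB(1666681,21,e)⊹ mB(1682209,21,e)⊹ mB(1692601,21,e)⊹ mB(1697809,21,e)⊹
    mB(1708249,21,e)⊹ mB(1739761,21,e)⊹ mB(1745041,21,e)⊹ mB(1760929,21,e)⊹ mB(1852321,21,e)⊹
    mB(1868689,21,e)⊹ mB(1885129,21,e)⊹ mB(1907161,21,e)⊹ mB(1957201,21,e)⊹ mB(1985281,21,e)⊹
    mB(2024929,21,e)⊹ mB(2036329,21,e)⊹ mB(2042041,21,e)⊹ mB(2053489,21,e)⊹ mB(2070721,21,e)⊹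
    mB(2093809,21,e)⊹ mB(2105401,21,e)⊹ mB(2111209,21,e)⊹ mB(2128681,21,e)⊹ mB(2163841,21,e)⊹
    mB(2193361,21,e)⊹ mB(2199289,21,e)⊹ mB(2211169,21,e)⊹ mB(2217121,21,e)⊹ mB(2229049,21,e)⊹
    mB(2247001,21,e)⊹ mB(2283121,21,e)⊹ mB(2319529,21,e)⊹ mB(2343961,21,e)⊹ mB(2380849,21,e)⊹ 0
def fB7 (e : Nat) : Nat :=
    mB(2399401,21,e)⊹ mB(2411809,21,e)⊹ mB(2430481,21,e)⊹ mB(2455489,21,e)⊹ mB(2468041,21,e)⊹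
    mB(2493241,21,e)⊹ mB(2505889,21,e)⊹ mB(2550409,21,e)⊹ mB(2563201,21,e)⊹ mB(2582449,21,e)⊹
    mB(2588881,21,e)⊹ mB(2601769,21,e)⊹ mB(2621161,21,e)⊹ mB(2627641,21,e)⊹ mB(2647129,21,e)⊹
    mB(2679769,21,e)⊹ mB(2745649,21,e)⊹ mB(2765569,21,e)⊹ mB(2778889,21,e)⊹ mB(2785561,21,e)⊹
    mB(2866249,21,e)⊹ mB(2879809,21,e)⊹ mB(2886601,21,e)⊹ mB(2920681,21,e)⊹ mB(2961841,21,e)⊹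
    mB(2968729,21,e)⊹ mB(3003289,21,e)⊹ 0
def fB (e : Nat) : Nat :=
    fB0 e⊹ fB1 e⊹ fB2 e⊹ fB3 e⊹ fB4 e⊹ fB5 e⊹ fB6 e⊹ fB7 e⊹ 0

def fW0 (s : Nat) : Nat :=
    mS(1,1,s)⊹ mS(6,1,s)⊹ mS(10,1,s)⊹ mS(14,1,s)⊹ mS(15,1,s)⊹ mS(21,1,s)⊹ mS(22,1,s)⊹ mS(26,1,s)⊹
    mS(33,1,s)⊹ mS(34,1,s)⊹ mS(35,1,s)⊹ mS(38,1,s)⊹ mS(39,1,s)⊹ mS(46,1,s)⊹ mS(51,1,s)⊹ mS(55,1,s)⊹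
    mS(57,1,s)⊹ mS(58,1,s)⊹ mS(62,1,s)⊹ mS(65,1,s)⊹ mS(69,1,s)⊹ mS(74,1,s)⊹ mS(77,1,s)⊹ mS(82,1,s)⊹
    mS(85,1,s)⊹ mS(86,1,s)⊹ mS(87,1,s)⊹ mS(91,1,s)⊹ mS(93,1,s)⊹ mS(94,1,s)⊹ mS(95,1,s)⊹
    mS(106,1,s)⊹ mS(111,1,s)⊹ mS(115,1,s)⊹ mS(118,1,s)⊹ mS(119,1,s)⊹ mS(122,1,s)⊹ mS(123,1,s)⊹
    mS(129,1,s)⊹ mS(133,1,s)⊹ mS(134,1,s)⊹ mS(141,1,s)⊹ mS(142,1,s)⊹ mS(143,1,s)⊹ mS(145,1,s)⊹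
    mS(146,1,s)⊹ mS(155,1,s)⊹ mS(158,1,s)⊹ mS(159,1,s)⊹ mS(161,1,s)⊹ mS(166,1,s)⊹ mS(177,1,s)⊹
    mS(178,1,s)⊹ mS(183,1,s)⊹ mS(185,1,s)⊹ mS(187,1,s)⊹ mS(194,1,s)⊹ mS(201,1,s)⊹ mS(202,1,s)⊹
    mS(203,1,s)⊹ mS(205,1,s)⊹ mS(206,1,s)⊹ mS(209,1,s)⊹ mS(210,1,s)⊹ mS(213,1,s)⊹ mS(214,1,s)⊹
    mS(215,1,s)⊹ mS(217,1,s)⊹ mS(218,1,s)⊹ mS(219,1,s)⊹ mS(221,1,s)⊹ mS(226,1,s)⊹ mS(235,1,s)⊹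
    mS(237,1,s)⊹ mS(247,1,s)⊹ mS(249,1,s)⊹ mS(253,1,s)⊹ mS(254,1,s)⊹ mS(259,1,s)⊹ mS(262,1,s)⊹
    mS(265,1,s)⊹ mS(267,1,s)⊹ mS(274,1,s)⊹ mS(278,1,s)⊹ mS(287,1,s)⊹ mS(291,1,s)⊹ mS(295,1,s)⊹
    mS(298,1,s)⊹ mS(299,1,s)⊹ mS(2,256,s)⊹ mS(3,256,s)⊹ mS(5,256,s)⊹ mS(7,256,s)⊹ mS(11,256,s)⊹
    mS(13,256,s)⊹ mS(17,256,s)⊹ mS(19,256,s)⊹ mS(23,256,s)⊹ mS(29,256,s)⊹ mS(30,256,s)⊹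
    mS(31,256,s)⊹ mS(37,256,s)⊹ mS(41,256,s)⊹ mS(42,256,s)⊹ mS(43,256,s)⊹ mS(47,256,s)⊹
    mS(53,256,s)⊹ mS(59,256,s)⊹ mS(61,256,s)⊹ mS(66,256,s)⊹ mS(67,256,s)⊹ mS(70,256,s)⊹
    mS(71,256,s)⊹ mS(73,256,s)⊹ mS(78,256,s)⊹ mS(79,256,s)⊹ mS(83,256,s)⊹ mS(89,256,s)⊹
    mS(97,256,s)⊹ mS(101,256,s)⊹ mS(102,256,s)⊹ mS(103,256,s)⊹ mS(105,256,s)⊹ mS(107,256,s)⊹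
    mS(109,256,s)⊹ mS(110,256,s)⊹ mS(113,256,s)⊹ mS(114,256,s)⊹ mS(127,256,s)⊹ mS(130,256,s)⊹
    mS(131,256,s)⊹ mS(137,256,s)⊹ mS(138,256,s)⊹ mS(139,256,s)⊹ mS(149,256,s)⊹ mS(151,256,s)⊹
    mS(154,256,s)⊹ mS(157,256,s)⊹ mS(163,256,s)⊹ mS(165,256,s)⊹ mS(167,256,s)⊹ mS(170,256,s)⊹
    mS(173,256,s)⊹ mS(174,256,s)⊹ mS(179,256,s)⊹ mS(181,256,s)⊹ mS(182,256,s)⊹ mS(186,256,s)⊹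
    mS(190,256,s)⊹ mS(191,256,s)⊹ mS(193,256,s)⊹ mS(195,256,s)⊹ mS(197,256,s)⊹ mS(199,256,s)⊹
    mS(211,256,s)⊹ mS(222,256,s)⊹ mS(223,256,s)⊹ mS(227,256,s)⊹ mS(229,256,s)⊹ mS(230,256,s)⊹
    mS(231,256,s)⊹ mS(233,256,s)⊹ mS(238,256,s)⊹ mS(239,256,s)⊹ mS(241,256,s)⊹ mS(246,256,s)⊹
    mS(251,256,s)⊹ mS(255,256,s)⊹ mS(257,256,s)⊹ mS(258,256,s)⊹ mS(263,256,s)⊹ mS(266,256,s)⊹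
    mS(269,256,s)⊹ mS(271,256,s)⊹ mS(273,256,s)⊹ mS(277,256,s)⊹ mS(281,256,s)⊹ mS(282,256,s)⊹
    mS(283,256,s)⊹ mS(285,256,s)⊹ mS(286,256,s)⊹ mS(290,256,s)⊹ mS(293,256,s)⊹ 0
def fW (s : Nat) : Nat :=
    fW0 s⊹ 0

def csP0 (t : Nat) : Nat :=
    mD(1,t)⊹ mD(6,t)⊹ mD(10,t)⊹ mD(14,t)⊹ mD(15,t)⊹ mD(21,t)⊹ mD(22,t)⊹ mD(26,t)⊹ mD(33,t)⊹
    mD(34,t)⊹ mD(35,t)⊹ mD(38,t)⊹ mD(39,t)⊹ mD(46,t)⊹ mD(51,t)⊹ mD(55,t)⊹ mD(57,t)⊹ mD(58,t)⊹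
    mD(62,t)⊹ mD(65,t)⊹ mD(69,t)⊹ mD(74,t)⊹ mD(77,t)⊹ mD(82,t)⊹ mD(85,t)⊹ mD(86,t)⊹ mD(87,t)⊹
    mD(91,t)⊹ mD(93,t)⊹ mD(94,t)⊹ mD(95,t)⊹ mD(106,t)⊹ mD(111,t)⊹ mD(115,t)⊹ mD(118,t)⊹ mD(119,t)⊹
    mD(122,t)⊹ mD(123,t)⊹ mD(129,t)⊹ mD(133,t)⊹ mD(134,t)⊹ mD(141,t)⊹ mD(142,t)⊹ mD(143,t)⊹
    mD(145,t)⊹ mD(146,t)⊹ mD(155,t)⊹ mD(158,t)⊹ mD(159,t)⊹ mD(161,t)⊹ mD(166,t)⊹ mD(177,t)⊹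
    mD(178,t)⊹ mD(183,t)⊹ mD(185,t)⊹ mD(187,t)⊹ mD(194,t)⊹ mD(201,t)⊹ mD(202,t)⊹ mD(203,t)⊹
    mD(205,t)⊹ mD(206,t)⊹ mD(209,t)⊹ mD(210,t)⊹ mD(213,t)⊹ mD(214,t)⊹ mD(215,t)⊹ mD(217,t)⊹
    mD(218,t)⊹ mD(219,t)⊹ mD(221,t)⊹ mD(226,t)⊹ mD(235,t)⊹ mD(237,t)⊹ mD(247,t)⊹ mD(249,t)⊹
    mD(253,t)⊹ mD(254,t)⊹ mD(259,t)⊹ mD(262,t)⊹ mD(265,t)⊹ mD(267,t)⊹ mD(274,t)⊹ mD(278,t)⊹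
    mD(287,t)⊹ mD(291,t)⊹ mD(295,t)⊹ mD(298,t)⊹ mD(299,t)⊹ 0
def csP (t : Nat) : Nat :=
    csP0 t⊹ 0

def csN0 (t : Nat) : Nat :=
    mD(2,t)⊹ mD(3,t)⊹ mD(5,t)⊹ mD(7,t)⊹ mD(11,t)⊹ mD(13,t)⊹ mD(17,t)⊹ mD(19,t)⊹ mD(23,t)⊹ mD(29,t)⊹
    mD(30,t)⊹ mD(31,t)⊹ mD(37,t)⊹ mD(41,t)⊹ mD(42,t)⊹ mD(43,t)⊹ mD(47,t)⊹ mD(53,t)⊹ mD(59,t)⊹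
    mD(61,t)⊹ mD(66,t)⊹ mD(67,t)⊹ mD(70,t)⊹ mD(71,t)⊹ mD(73,t)⊹ mD(78,t)⊹ mD(79,t)⊹ mD(83,t)⊹
    mD(89,t)⊹ mD(97,t)⊹ mD(101,t)⊹ mD(102,t)⊹ mD(103,t)⊹ mD(105,t)⊹ mD(107,t)⊹ mD(109,t)⊹
    mD(110,t)⊹ mD(113,t)⊹ mD(114,t)⊹ mD(127,t)⊹ mD(130,t)⊹ mD(131,t)⊹ mD(137,t)⊹ mD(138,t)⊹
    mD(139,t)⊹ mD(149,t)⊹ mD(151,t)⊹ mD(154,t)⊹ mD(157,t)⊹ mD(163,t)⊹ mD(165,t)⊹ mD(167,t)⊹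
    mD(170,t)⊹ mD(173,t)⊹ mD(174,t)⊹ mD(179,t)⊹ mD(181,t)⊹ mD(182,t)⊹ mD(186,t)⊹ mD(190,t)⊹
    mD(191,t)⊹ mD(193,t)⊹ mD(195,t)⊹ mD(197,t)⊹ mD(199,t)⊹ mD(211,t)⊹ mD(222,t)⊹ mD(223,t)⊹
    mD(227,t)⊹ mD(229,t)⊹ mD(230,t)⊹ mD(231,t)⊹ mD(233,t)⊹ mD(238,t)⊹ mD(239,t)⊹ mD(241,t)⊹
    mD(246,t)⊹ mD(251,t)⊹ mD(255,t)⊹ mD(257,t)⊹ mD(258,t)⊹ mD(263,t)⊹ mD(266,t)⊹ mD(269,t)⊹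
    mD(271,t)⊹ mD(273,t)⊹ mD(277,t)⊹ mD(281,t)⊹ mD(282,t)⊹ mD(283,t)⊹ mD(285,t)⊹ mD(286,t)⊹
    mD(290,t)⊹ mD(293,t)⊹ 0
def csN (t : Nat) : Nat :=
    csN0 t⊹ 0


def ones : Nat := Nat.mod (maskOf (nat_lit 1) (nat_lit 1)) (Nat.pow (nat_lit 2) (nat_lit 131072))

def fieldF (s : Nat) : Nat :=
  Nat.mod (Nat.add (fS s) (fB (Nat.add s (nat_lit 8191)))) (Nat.pow (nat_lit 2) (nat_lit 131072))

def thr (s : Nat) : Nat :=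
  Nat.div (Nat.add (Nat.mul (nat_lit 7) (Nat.log2 s)) (nat_lit 3)) (nat_lit 4)

def bitsOf (s F : Nat) : Nat :=
  Nat.land (Nat.xor (Nat.shiftRight (Nat.add F (Nat.mul (Nat.sub (nat_lit 32768)
    (thr s)) ones)) (nat_lit 15)) F) ones

def lval (B Ltop s v : Nat) : Nat :=
  Nat.add (Nat.add Ltop (Nat.sub (Nat.add s (nat_lit 8191)) v))
    (Nat.mul (nat_lit 1099511627774)
      (Nat.mod (Nat.shiftRight B (Nat.mul (nat_lit 16) (Nat.sub (Nat.add v (nat_lit 1)) s)))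
        (nat_lit 65535)))

def cval (f : Nat) : Nat :=
  Nat.add (Nat.mod f (nat_lit 256)) (Nat.mul (nat_lit 1099511627775) (Nat.div f (nat_lit 256)))

def jterm (B Ltop s ct j1 i : Nat) : Nat :=
  Nat.mul (cval (Nat.mod (Nat.shiftRight ct (Nat.mul (nat_lit 16) i)) (nat_lit 65536)))
    (lval B Ltop s (Nat.div (nat_lit 906150257) (Nat.add j1 i)))

noncomputable def jloop (B Ltop s ct j1 len : Nat) : Nat → Nat :=
  Nat.rec (motive := fun _ => Nat → Nat) (fun acc => acc)
    (fun i ih acc => force (Nat.add acc (jterm B Ltop s ct j1 i)) ih) len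

/-- sum over `j ∈ (jlo, jhi]`, in `D` pieces of length at most 8192 -/
noncomputable def jrange (B Ltop s jlo jhi D : Nat) : Nat → Nat :=
  Nat.rec (motive := fun _ => Nat → Nat) (fun acc => acc)
    (fun d ih acc => force (Nat.add jlo (Nat.mul (nat_lit 8192) d)) fun j0 =>
      force (Nat.add j0 (nat_lit 1)) fun j1 =>
      force (fW j1) fun ct =>
      force (Nat.sub (nat_lit 8192) (Nat.sub (nat_lit 8192) (Nat.sub jhi j0))) fun len =>
      force (jloop B Ltop s ct j1 len acc) ih) D

/-- One round of the main loop. -/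
noncomputable def runBody (ih : Nat → Nat → Nat → Nat) (k base acc : Nat) : Nat :=
  force (Nat.mul (nat_lit 8192) k) fun s =>
  force (fieldF s) fun F =>
  force (bitsOf s F) fun B =>
  force (Nat.mod (Nat.add base (Nat.add (Nat.mul (nat_lit 2) (Nat.mod B (nat_lit 65535)))
    (nat_lit 1099511619584))) (nat_lit 1099511627776)) fun Ltop =>
  force (Nat.div (nat_lit 906150257) s) fun jhi =>
  force (Nat.div (nat_lit 906150257) (Nat.add s (nat_lit 8192))) fun jlo =>
  force (Nat.div (Nat.add (Nat.sub jhi jlo) (nat_lit 8191)) (nat_lit 8192)) fun D =>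
  force (Nat.mod (jrange B Ltop s jlo jhi D acc) (nat_lit 1099511627776)) fun acc' =>
  force (Nat.add k (nat_lit 1)) fun k' =>
  ih k' Ltop acc'

noncomputable def run (n : Nat) : Nat → Nat → Nat → Nat :=
  Nat.rec (motive := fun _ => Nat → Nat → Nat → Nat)
    (fun _ base acc => Nat.add acc (Nat.mul (nat_lit 1099511627776) base))
    (fun _ ih => runBody ih) n

/-- `C(t)` modulo `2^40` -/
def cumC (t : Nat) : Nat := Nat.add (csP t) (Nat.mul (nat_lit 1099511627775) (csN t))

def aterm (B s cJ a : Nat) : Nat :=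
  Nat.mul (Nat.add (Nat.mul (nat_lit 2) (Nat.mod (Nat.shiftRight B (Nat.mul (nat_lit 16) (Nat.sub a s))) (nat_lit 2)))
      (nat_lit 1099511627775))
    (force (Nat.div (nat_lit 906150257) a) fun t => Nat.add (cumC t) cJ)

noncomputable def aloop (B s cJ a1 len : Nat) : Nat → Nat :=
  Nat.rec (motive := fun _ => Nat → Nat) (fun acc => acc)
    (fun i ih acc => force (Nat.add acc (aterm B s cJ (Nat.add a1 i))) ih) len

/-- `a1 ≤ a < a1 + len` inside the window `[s, s + 2048)`, `a1 + len = s + 2048` -/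
noncomputable def runA (s a1 len base acc : Nat) : Nat :=
  force (fieldF s) fun F =>
  force (Nat.mod (bitsOf s F) (Nat.pow (nat_lit 2) (nat_lit 32768))) fun B =>
  force (Nat.mul (nat_lit 1099511627775) (cumC (nat_lit 55307))) fun cJ =>
  force (Nat.mod (aloop B s cJ a1 len acc) (nat_lit 1099511627776)) fun acc' =>
  Nat.add acc' (Nat.mul (nat_lit 1099511627776)
    (Nat.mod (Nat.add base (Nat.add (Nat.mul (nat_lit 2) (Nat.mod (Nat.shiftRight B
      (Nat.mul (nat_lit 16) (Nat.sub a1 s))) (nat_lit 65535)))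
        (Nat.sub (nat_lit 1099511627776) len))) (nat_lit 1099511627776)))


/-- Sum of the shifted masks. -/
def lS (Q : List (ℕ × ℕ)) (s : ℕ) : ℕ := (Q.map fun p => mS(p.1, p.2, s)).sum
/-- Sum of the single hits. -/
def lB (Q : List (ℕ × ℕ)) (e : ℕ) : ℕ := (Q.map fun p => mB(p.1, p.2, e)).sum

lemma lS_nil (s : ℕ) : lS [] s = 0 := rfl
lemma lB_nil (s : ℕ) : lB [] s = 0 := rfl
lemma cum_nil (s : ℕ) : cum [] s = 0 := rfl
lemma lS_cons (q w : ℕ) (Q : List (ℕ × ℕ)) (s : ℕ) :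
    lS ((q, w) :: Q) s = Nat.add mS(q, w, s) (lS Q s) := by
  rw [lS, List.map_cons, List.sum_cons]; rfl
lemma lB_cons (q w : ℕ) (Q : List (ℕ × ℕ)) (s : ℕ) :
    lB ((q, w) :: Q) s = Nat.add mB(q, w, s) (lB Q s) := by
  rw [lB, List.map_cons, List.sum_cons]; rfl
lemma cum_cons (m : ℕ) (W : List ℕ) (t : ℕ) : cum (m :: W) t = Nat.add mD(m, t) (cum W t) := by
  rw [cum, List.map_cons, List.sum_cons]; rfl
lemma lS_append (Q R : List (ℕ × ℕ)) (s : ℕ) : lS (Q ++ R) s = Nat.add (lS Q s) (lS R s) := by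
  rw [lS, List.map_append, List.sum_append]; rfl
lemma lB_append (Q R : List (ℕ × ℕ)) (s : ℕ) : lB (Q ++ R) s = Nat.add (lB Q s) (lB R s) := by
  rw [lB, List.map_append, List.sum_append]; rfl

lemma fS0_eq (s : ℕ) : fS0 s = lS QS0 s := by
  unfold QS0; simp only [lS_cons, lS_nil]; delta fS0; with_reducible rfl
lemma fS1_eq (s : ℕ) : fS1 s = lS QS1 s := by
  unfold QS1; simp only [lS_cons, lS_nil]; delta fS1; with_reducible rfl
lemma fS2_eq (s : ℕ) : fS2 s = lS QS2 s := by
  unfold QS2; simp only [lS_cons, lS_nil]; delta fS2; with_reducible rfl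
lemma fS3_eq (s : ℕ) : fS3 s = lS QS3 s := by
  unfold QS3; simp only [lS_cons, lS_nil]; delta fS3; with_reducible rfl
lemma fS4_eq (s : ℕ) : fS4 s = lS QS4 s := by
  unfold QS4; simp only [lS_cons, lS_nil]; delta fS4; with_reducible rfl
lemma fS5_eq (s : ℕ) : fS5 s = lS QS5 s := by
  unfold QS5; simp only [lS_cons, lS_nil]; delta fS5; with_reducible rfl
lemma fS6_eq (s : ℕ) : fS6 s = lS QS6 s := by
  unfold QS6; simp only [lS_cons, lS_nil]; delta fS6; with_reducible rfl
lemma fS7_eq (s : ℕ) : fS7 s = lS QS7 s := by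
  unfold QS7; simp only [lS_cons, lS_nil]; delta fS7; with_reducible rfl
lemma fS8_eq (s : ℕ) : fS8 s = lS QS8 s := by
  unfold QS8; simp only [lS_cons, lS_nil]; delta fS8; with_reducible rfl
lemma fB0_eq (e : ℕ) : fB0 e = lB QB0 e := by
  unfold QB0; simp only [lB_cons, lB_nil]; delta fB0; with_reducible rfl
lemma fB1_eq (e : ℕ) : fB1 e = lB QB1 e := by
  unfold QB1; simp only [lB_cons, lB_nil]; delta fB1; with_reducible rfl
lemma fB2_eq (e : ℕ) : fB2 e = lB QB2 e := by
  unfold QB2; simp only [lB_cons, lB_nil]; delta fB2; with_reducible rfl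
lemma fB3_eq (e : ℕ) : fB3 e = lB QB3 e := by
  unfold QB3; simp only [lB_cons, lB_nil]; delta fB3; with_reducible rfl
lemma fB4_eq (e : ℕ) : fB4 e = lB QB4 e := by
  unfold QB4; simp only [lB_cons, lB_nil]; delta fB4; with_reducible rfl
lemma fB5_eq (e : ℕ) : fB5 e = lB QB5 e := by
  unfold QB5; simp only [lB_cons, lB_nil]; delta fB5; with_reducible rfl
lemma fB6_eq (e : ℕ) : fB6 e = lB QB6 e := by
  unfold QB6; simp only [lB_cons, lB_nil]; delta fB6; with_reducible rfl
lemma fB7_eq (e : ℕ) : fB7 e = lB QB7 e := by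
  unfold QB7; simp only [lB_cons, lB_nil]; delta fB7; with_reducible rfl
lemma fS_eq (s : ℕ) : fS s = lS QS s := by
  unfold QS; simp only [lS_append, lS_nil, ← fS0_eq, ← fS1_eq, ← fS2_eq, ← fS3_eq, ← fS4_eq, ← fS5_eq, ← fS6_eq, ← fS7_eq, ← fS8_eq]
  delta fS; with_reducible rfl
lemma fB_eq (e : ℕ) : fB e = lB QB e := by
  unfold QB; simp only [lB_append, lB_nil, ← fB0_eq, ← fB1_eq, ← fB2_eq, ← fB3_eq, ← fB4_eq, ← fB5_eq, ← fB6_eq, ← fB7_eq]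
  delta fB; with_reducible rfl

/-- The table of divisors used for the coefficients. -/
def QW : List (ℕ × ℕ) := WP.map (fun m => (m, 1)) ++ WN.map (fun m => (m, 256))
lemma fW_eq (s : ℕ) : fW s = lS QW s := by
  have h : fW s = fW0 s := Nat.add_zero _
  rw [h]
  unfold QW WP WN
  simp only [List.map_cons, List.map_nil, List.cons_append, List.nil_append, lS_cons, lS_nil]
  delta fW0; with_reducible rfl
lemma csP_eq (t : ℕ) : csP t = cum WP t := by
  have h : csP t = csP0 t := Nat.add_zero _
  rw [h]
  unfold WP
  simp only [cum_cons, cum_nil]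
  delta csP0; with_reducible rfl
lemma csN_eq (t : ℕ) : csN t = cum WN t := by
  have h : csN t = csN0 t := Nat.add_zero _
  rw [h]
  unfold WN
  simp only [cum_cons, cum_nil]
  delta csN0; with_reducible rfl
/-! ### Specification of the windows -/

lemma force_eq (x : ℕ) (k : ℕ → ℕ) : force x k = k x := rfl

lemma maskOf_eq (q w : ℕ) :
    maskOf q w = w * ((2 ^ (16 * (q * (8192 / q + 2))) - 1) / (2 ^ (16 * q) - 1)) := rfl

lemma qsum_cons (p : ℕ × ℕ) (Q : List (ℕ × ℕ)) (s i : ℕ) :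
    qsum (p :: Q) (s + i) = hit p.1 p.2 s i + qsum Q (s + i) := rfl

lemma pack_zero (C : ℕ) : pack (fun _ => 0) C = 0 := by simp [pack]

lemma lS_modEq (Q : List (ℕ × ℕ)) (s : ℕ) (hQ : ∀ p ∈ Q, 0 < p.1 ∧ p.2 < 65536) :
    lS Q s ≡ pack (fun i => qsum Q (s + i)) 8192 [MOD 2 ^ (16 * 8192)] := by
  induction Q with
  | nil =>
    have : (fun i => qsum [] (s + i)) = fun _ => 0 := rfl
    rw [this, pack_zero, lS_nil]
  | cons p Q ih =>
    have ih := ih fun a ha => hQ a (by simp [ha])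
    have hp := hQ p (by simp)
    obtain ⟨q, w⟩ := p
    rw [lS_cons]
    simp only [qsum_cons]
    rw [← pack_add]
    exact (small_hit q w s 8192 hp.1 hp.2).add ih

lemma lB_eq (Q : List (ℕ × ℕ)) (s : ℕ) (hQ : ∀ p ∈ Q, 8192 ≤ p.1) :
    lB Q (s + 8191) = pack (fun i => qsum Q (s + i)) 8192 := by
  induction Q with
  | nil =>
    have : (fun i => qsum [] (s + i)) = fun _ => 0 := rfl
    rw [this, pack_zero, lB_nil]
  | cons p Q ih =>
    have ih := ih fun a ha => hQ a (by simp [ha])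
    have hp := hQ p (by simp)
    obtain ⟨q, w⟩ := p
    rw [lB_cons]
    simp only [qsum_cons]
    rw [← pack_add, ← ih]
    have hb := big_hit q w s 8191 hp
    rw [show 8191 + 1 = 8192 by rfl, show 16 * 8192 = 131072 by rfl] at hb
    rw [← hb]
    rfl

lemma qsum_le (Q : List (ℕ × ℕ)) (n : ℕ) : qsum Q n ≤ (Q.map Prod.snd).sum := by
  unfold qsum
  apply List.sum_le_sum
  intro p _
  split_ifs <;> omega

set_option linter.defProp false in
def QS_total : Nat.blt ((QS.map Prod.snd).sum + (QB.map Prod.snd).sum) 32768 = true := by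
  decide +kernel

set_option linter.defProp false in
def QS_bounds : QS.all (fun p => Nat.blt 0 p.1 && Nat.blt p.2 65536) = true := by
  decide +kernel

set_option linter.defProp false in
def QB_bounds : QB.all (fun p => Nat.ble 8192 p.1) = true := by
  decide +kernel

/-- Contents of the field of `n`. -/
def fld (n : ℕ) : ℕ := qsum QS n + qsum QB n

lemma fld_lt (n : ℕ) : fld n < 32768 := by
  have h1 := qsum_le QS n
  have h2 := qsum_le QB n
  have h3 := Eq.mp Nat.blt_eq QS_total
  unfold fld
  omega

lemma fieldF_def (s : ℕ) : fieldF s = (fS s + fB (s + 8191)) % 2 ^ (16 * 8192) := by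
  rw [show 16 * 8192 = 131072 by rfl]
  rfl

lemma fieldF_eq (s : ℕ) : fieldF s = pack (fun i => fld (s + i)) 8192 := by
  rw [fieldF_def, fS_eq, fB_eq, lB_eq QB s]
  · have h1 := lS_modEq QS s (by
      intro p hp
      have := List.all_eq_true.1 QS_bounds p hp
      simp only [Bool.and_eq_true, Nat.blt_eq] at this
      exact this)
    have h2 := h1.add_right (pack (fun i => qsum QB (s + i)) 8192)
    have e : (fun i => qsum QS (s + i) + qsum QB (s + i)) = fun i => fld (s + i) := rfl
    rw [pack_add, e, Nat.ModEq] at h2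
    have h3 := pack_mod (fun i => fld (s + i)) 8192 8192
      (fun i _ => (fld_lt _).trans (by norm_num)) le_rfl
    rw [h2, h3]
  · intro p hp
    exact Eq.mp Nat.ble_eq (List.all_eq_true.1 QB_bounds p hp)

lemma mod_pow_aux (m e : ℕ) : Nat.mod m (Nat.pow (nat_lit 2) e) = m % 2 ^ e := rfl

lemma mask_mod (q w : ℕ) (hq : 0 < q) (hw : w < 65536) :
    maskOf q w % 2 ^ (16 * 8192) = pack (hit q w 0) 8192 := by
  have h2 := small_hit q w 0 8192 hq hw
  rw [← maskOf_eq, Nat.ModEq, Nat.zero_mod, mul_zero, Nat.shiftRight_zero] at h2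
  rw [h2]
  exact pack_mod (hit q w 0) 8192 8192 (fun i _ => (hit_le q w 0 i).trans_lt hw) le_rfl

lemma hit_one : hit 1 1 0 = fun _ => 1 := by
  funext i
  simp [hit]

lemma mask_mod2 (q w : ℕ) (hq : 0 < q) (hw : w < 65536) :
    Nat.mod (maskOf q w) (Nat.pow (nat_lit 2) (nat_lit 131072)) = pack (hit q w 0) 8192 := by
  rw [mod_pow_aux, ← mask_mod q w hq hw]

lemma ones_eq : ones = pack (fun _ => 1) 8192 := by
  unfold ones
  rw [← hit_one]
  exact mask_mod2 (nat_lit 1) (nat_lit 1) Nat.one_pos (by norm_num)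

/-- The bit which is `1` iff `λ (s + i) = 1`. -/
def bt (s i : ℕ) : ℕ :=
  if (thr s ≤ fld (s + i) ∧ fld (s + i) % 2 = 0) ∨ (fld (s + i) < thr s ∧ fld (s + i) % 2 = 1)
  then 1 else 0

lemma bt_lt (s i : ℕ) : bt s i < 2 := by
  unfold bt; split_ifs <;> norm_num

lemma thr_eq (s : ℕ) : thr s = (7 * Nat.log2 s + 3) / 4 := rfl

lemma bitsOf_eq (s : ℕ) (hs : s < 3014656) : bitsOf s (fieldF s) = pack (bt s) 8192 := by
  have h : bitsOf s (fieldF s) =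
    ((fieldF s + (32768 - thr s) * ones) >>> 15 ^^^ fieldF s) &&& ones := rfl
  rw [h, ones_eq, fieldF_eq]
  refine bits_pack _ _ _ (fun i _ => fld_lt _) ?_
  have : Nat.log2 s < 22 := by
    rcases Nat.eq_zero_or_pos s with rfl | h0
    · simp
    · rw [Nat.log2_lt (by omega)]; omega
  rw [thr_eq]
  omega

lemma log2_window (e k i : ℕ) (hk : 1 ≤ k) (hi : i < 2 ^ e) :
    Nat.log2 (2 ^ e * k + i) = Nat.log2 (2 ^ e * k) := by
  have h0 : 0 < 2 ^ e := by positivity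
  have hs : 2 ^ e * 1 ≤ 2 ^ e * k := Nat.mul_le_mul_left _ hk
  rw [Nat.log2_eq_iff (by omega)]
  have h1 := Nat.log2_self_le (n := 2 ^ e * k) (by omega)
  have h2 := Nat.lt_log2_self (n := 2 ^ e * k)
  refine ⟨by omega, ?_⟩
  have he : e ≤ Nat.log2 (2 ^ e * k) := (Nat.le_log2 (by omega)).2 (by omega)
  obtain ⟨d, hd⟩ := Nat.exists_eq_add_of_le he
  rw [hd, show e + d + 1 = e + (d + 1) by ring, pow_add] at h2 ⊢
  have h3 : k < 2 ^ (d + 1) := Nat.lt_of_mul_lt_mul_left h2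
  calc 2 ^ e * k + i < 2 ^ e * k + 2 ^ e := by omega
    _ = 2 ^ e * (k + 1) := by ring
    _ ≤ _ := Nat.mul_le_mul_left _ h3

lemma bt_spec (s i : ℕ) (h1 : 1 ≤ s + i) (h2 : s + i < 3014656)
    (h : Nat.log2 (s + i) = Nat.log2 s ∨ (s = 0 ∧ i < 2048)) :
    liouvilleFn (s + i) = 2 * (bt s i : ℤ) - 1 := by
  rw [sieve (s + i) (thr s) h1 (by omega)]
  · unfold bt
    have : wsum (s + i) = fld (s + i) := (wsum_eq _ h1 h2).symm
    rw [this]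
    split_ifs <;> norm_num
  · rcases h with h | ⟨rfl, h⟩
    · left; rw [h]; rfl
    · right; exact ⟨by rw [thr_eq]; simp, by omega⟩

lemma LL_add (b m : ℕ) : LL (b + m) = LL b + ∑ i ∈ range m, liouvilleFn (b + 1 + i) := by
  induction m with
  | zero => simp
  | succ m ih =>
    rw [← add_assoc, LL_succ, ih, sum_range_succ]
    rw [show b + 1 + m = b + m + 1 by ring]
    ring

lemma sum_bits (s t m : ℕ) (h1 : 1 ≤ s + t)
    (hb : ∀ i < m, liouvilleFn (s + (t + i)) = 2 * (bt s (t + i) : ℤ) - 1) :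
    LL (s + t - 1 + m) = LL (s + t - 1) + (2 * ((∑ i ∈ range m, bt s (t + i) : ℕ) : ℤ) - m) := by
  rw [LL_add]
  congr 1
  push_cast
  rw [mul_sum]
  have : ∀ i ∈ range m, liouvilleFn (s + t - 1 + 1 + i) = 2 * (bt s (t + i) : ℤ) - 1 := by
    intro i hi
    rw [← hb i (mem_range.1 hi)]
    congr 1; omega
  rw [sum_congr rfl this, sum_sub_distrib]
  simp

lemma pack_tail (s t C : ℕ) (ht : t ≤ C) (hC : C ≤ 8192) :
    pack (bt s) C >>> (16 * t) % 65535 = ∑ i ∈ range (C - t), bt s (t + i) := by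
  rw [pack_shift _ _ _ (fun i _ => (bt_lt s i).trans (by norm_num)) ht, pack_mod65535]
  calc ∑ i ∈ range (C - t), bt s (t + i) ≤ ∑ i ∈ range (C - t), 1 :=
        sum_le_sum fun i _ => Nat.le_of_lt_succ (bt_lt _ _)
    _ = C - t := by simp
    _ < 65535 := by omega


/-! ### Specification of the loops -/

lemma digit_of_modEq (a : ℕ) (f : ℕ → ℕ) (C i : ℕ) (h : a ≡ pack f C [MOD 2 ^ (16 * C)])
    (hf : ∀ i < C, f i < 65536) (hi : i < C) : a >>> (16 * i) % 65536 = f i := by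
  rw [← pack_digit f C i hf hi, show (65536 : ℕ) = 2 ^ 16 by norm_num]
  have hp : pack f C % 2 ^ (16 * C) = a % 2 ^ (16 * C) := h.symm
  apply Nat.eq_of_testBit_eq
  intro j
  rw [Nat.testBit_mod_two_pow, Nat.testBit_mod_two_pow, Nat.testBit_shiftRight,
    Nat.testBit_shiftRight]
  by_cases hj : j < 16
  · have h1 := Nat.testBit_mod_two_pow a (16 * C) (16 * i + j)
    have h2 := Nat.testBit_mod_two_pow (pack f C) (16 * C) (16 * i + j)
    rw [hp, h1] at h2
    have : 16 * i + j < 16 * C := by omega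
    simp only [this, decide_true, Bool.true_and] at h2
    rw [h2]
  · simp [hj]

lemma cnt_le (W : List ℕ) (j : ℕ) : cnt W j ≤ W.length := by
  unfold cnt
  induction W with
  | nil => simp
  | cons m W ih =>
    rw [List.map_cons, List.sum_cons, List.length_cons]
    split_ifs <;> omega

lemma qsum_map (W : List ℕ) (w j : ℕ) : qsum (W.map fun m => (m, w)) j = w * cnt W j := by
  unfold qsum cnt
  induction W with
  | nil => simp
  | cons m W ih =>
    rw [List.map_cons, List.map_cons, List.sum_cons, List.map_cons, List.sum_cons, ih]
    split_ifs <;> ring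

lemma qsum_QW (j : ℕ) : qsum QW j = cnt WP j + 256 * cnt WN j := by
  have : qsum QW j = qsum (WP.map fun m => (m, 1)) j + qsum (WN.map fun m => (m, 256)) j := by
    unfold QW qsum
    rw [List.map_append, List.sum_append]
  rw [this, qsum_map, qsum_map, one_mul]

lemma cntP_lt (j : ℕ) : cnt WP j < 256 := (cnt_le WP j).trans_lt (by decide)
lemma cntN_lt (j : ℕ) : cnt WN j < 256 := (cnt_le WN j).trans_lt (by decide)

lemma WP_pos : ∀ m ∈ WP, 0 < m := by decide
lemma WN_pos : ∀ m ∈ WN, 0 < m := by decide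

lemma QW_bounds : ∀ p ∈ QW, 0 < p.1 ∧ p.2 < 65536 := by
  intro p hp
  unfold QW at hp
  rw [List.mem_append, List.mem_map, List.mem_map] at hp
  rcases hp with ⟨m, hm, rfl⟩ | ⟨m, hm, rfl⟩
  · exact ⟨WP_pos m hm, by norm_num⟩
  · exact ⟨WN_pos m hm, by norm_num⟩

lemma fW_digit (j i : ℕ) (hi : i < 8192) :
    fW j >>> (16 * i) % 65536 = cnt WP (j + i) + 256 * cnt WN (j + i) := by
  rw [fW_eq, ← qsum_QW]
  refine digit_of_modEq _ (fun i => qsum QW (j + i)) 8192 i (lS_modEq QW j QW_bounds) ?_ hi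
  intro i _
  have h1 := cntP_lt (j + i)
  have h2 := cntN_lt (j + i)
  simp only [qsum_QW]
  omega

/-- The coefficient of `L(x / j)`. -/
def cc (j : ℕ) : ℤ := (cnt WP j : ℤ) - cnt WN j

section ring

variable {R : Type} [CommRing R]

lemma cast_mod (hM : (1099511627776 : R) = 0) (a : ℕ) :
    ((a % 1099511627776 : ℕ) : R) = a := by
  have h := congrArg (Nat.cast (R := R)) (Nat.mod_add_div a 1099511627776)
  push_cast at h
  rw [hM] at h
  simpa using h

lemma cval_cast (hM : (1099511627776 : R) = 0) (j : ℕ) :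
    (cval (cnt WP j + 256 * cnt WN j) : R) = (cc j : ℤ) := by
  have h : cval (cnt WP j + 256 * cnt WN j) = (cnt WP j + 256 * cnt WN j) % 256
    + 1099511627775 * ((cnt WP j + 256 * cnt WN j) / 256) := rfl
  have h1 := cntP_lt j
  rw [h, show (cnt WP j + 256 * cnt WN j) % 256 = cnt WP j by omega,
    show (cnt WP j + 256 * cnt WN j) / 256 = cnt WN j by omega, cc]
  push_cast
  linear_combination (cnt WN j : R) * hM

lemma lam_window (k i : ℕ) (hk : 1 ≤ k) (hk2 : k < 368) (hi : i < 8192) :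
    liouvilleFn (8192 * k + i) = 2 * (bt (8192 * k) i : ℤ) - 1 := by
  refine bt_spec _ _ (by omega) (by omega) (Or.inl ?_)
  have := log2_window 13 k i hk (by omega)
  rwa [show 2 ^ 13 = 8192 by norm_num] at this

lemma lval_cast (hM : (1099511627776 : R) = 0) (k v Ltop : ℕ) (hk : 1 ≤ k) (hk2 : k < 368)
    (hv : 8192 * k ≤ v) (hv2 : v < 8192 * k + 8192)
    (hL : (Ltop : R) = (LL (8192 * k + 8191) : ℤ)) :
    (lval (pack (bt (8192 * k)) 8192) Ltop (8192 * k) v : R) = (LL v : ℤ) := by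
  have h : ∀ B s, lval B Ltop s v
    = (Ltop + (s + 8191 - v)) + 1099511627774 * (B >>> (16 * (v + 1 - s)) % 65535) :=
    fun _ _ => rfl
  rw [h, pack_tail _ _ 8192 (by omega) le_rfl]
  have h1 := sum_bits (8192 * k) (v + 1 - 8192 * k) (8192 - (v + 1 - 8192 * k)) (by omega) (by
    intro i hi
    exact lam_window k _ hk hk2 (by omega))
  rw [show 8192 * k + (v + 1 - 8192 * k) - 1 = v by omega,
    show v + (8192 - (v + 1 - 8192 * k)) = 8192 * k + 8191 by omega] at h1
  rw [show 8192 * k + 8191 - v = 8192 - (v + 1 - 8192 * k) by omega]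
  generalize 8192 - (v + 1 - 8192 * k) = m at *
  generalize (∑ i ∈ range m, bt (8192 * k) (v + 1 - 8192 * k + i)) = S at *
  rw [h1] at hL
  push_cast at hL ⊢
  linear_combination hL + (S : R) * hM

lemma jloop_eq (B Ltop s ct j1 len acc : ℕ) :
    jloop B Ltop s ct j1 len acc = acc + ∑ i ∈ range len, jterm B Ltop s ct j1 i := by
  induction len generalizing acc with
  | zero => rfl
  | succ n ih =>
    have h : jloop B Ltop s ct j1 (n + 1) acc
      = jloop B Ltop s ct j1 n (acc + jterm B Ltop s ct j1 n) := rfl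
    rw [h, ih, sum_range_succ]
    ring

/-- The summand attached to `j`. -/
def gg (j : ℕ) : ℤ := cc j * LL (906150257 / j)

lemma jterm_cast (hM : (1099511627776 : R) = 0) (k Ltop j1 i : ℕ) (hk : 1 ≤ k) (hk2 : k < 368)
    (hi : i < 8192)
    (hv : 8192 * k ≤ 906150257 / (j1 + i)) (hv2 : 906150257 / (j1 + i) < 8192 * k + 8192)
    (hL : (Ltop : R) = (LL (8192 * k + 8191) : ℤ)) :
    (jterm (pack (bt (8192 * k)) 8192) Ltop (8192 * k) (fW j1) j1 i : R) = (gg (j1 + i) : ℤ) := by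
  have h : ∀ B s, jterm B Ltop s (fW j1) j1 i
    = cval (fW j1 >>> (16 * i) % 65536) * lval B Ltop s (906150257 / (j1 + i)) :=
    fun _ _ => rfl
  rw [h, fW_digit j1 i hi, Nat.cast_mul, cval_cast hM, lval_cast hM k _ Ltop hk hk2 hv hv2 hL,
    gg, Int.cast_mul]

lemma sum_shift (g : ℕ → R) (a n : ℕ) :
    ∑ i ∈ range n, g (a + 1 + i) = ∑ j ∈ Ioc a (a + n), g j := by
  induction n with
  | zero => simp
  | succ n ih =>
    rw [sum_range_succ, ih, ← add_assoc, Finset.sum_Ioc_succ_top (by omega)]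
    congr 2
    ring

lemma jrange_cast (hM : (1099511627776 : R) = 0) (k Ltop jlo jhi D acc : ℕ) (hk : 1 ≤ k)
    (hk2 : k < 368) (hlh : jlo ≤ jhi)
    (hj : ∀ j, jlo < j → j ≤ jhi →
      8192 * k ≤ 906150257 / j ∧ 906150257 / j < 8192 * k + 8192)
    (hL : (Ltop : R) = (LL (8192 * k + 8191) : ℤ)) :
    (jrange (pack (bt (8192 * k)) 8192) Ltop (8192 * k) jlo jhi D acc : R)
      = acc + ∑ j ∈ Ioc jlo (min jhi (jlo + 8192 * D)), ((gg j : ℤ) : R) := by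
  generalize hB : pack (bt (8192 * k)) 8192 = B
  induction D generalizing acc with
  | zero =>
    have h : jrange B Ltop (8192 * k) jlo jhi 0 acc = acc := rfl
    rw [h]
    simp [hlh]
  | succ d ih =>
    have h : jrange B Ltop (8192 * k) jlo jhi (d + 1) acc
      = jrange B Ltop (8192 * k) jlo jhi d (jloop B Ltop (8192 * k) (fW (jlo + 8192 * d + 1))
        (jlo + 8192 * d + 1) (8192 - (8192 - (jhi - (jlo + 8192 * d)))) acc) := rfl
    rw [h, ih, jloop_eq, Nat.cast_add, Nat.cast_sum]
    have hs : ∀ i ∈ range (8192 - (8192 - (jhi - (jlo + 8192 * d)))),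
        ((jterm B Ltop (8192 * k) (fW (jlo + 8192 * d + 1)) (jlo + 8192 * d + 1) i : ℕ) : R)
          = ((gg (jlo + 8192 * d + 1 + i) : ℤ) : R) := by
      intro i hi
      rw [mem_range] at hi
      have h1 := hj (jlo + 8192 * d + 1 + i) (by omega) (by omega)
      rw [← hB]
      exact jterm_cast hM k Ltop _ i hk hk2 (by omega) h1.1 h1.2 hL
    rw [sum_congr rfl hs, sum_shift (fun j => ((gg j : ℤ) : R))]
    by_cases hc : jlo + 8192 * d ≤ jhi
    · rw [min_eq_right hc,
        show jlo + 8192 * d + (8192 - (8192 - (jhi - (jlo + 8192 * d))))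
          = min jhi (jlo + 8192 * (d + 1)) by omega,
        ← Finset.sum_Ioc_consecutive (fun j => ((gg j : ℤ) : R))
          (show jlo ≤ jlo + 8192 * d by omega)
          (show jlo + 8192 * d ≤ min jhi (jlo + 8192 * (d + 1)) by omega)]
      ring
    · rw [min_eq_left (by omega), min_eq_left (by omega),
        show 8192 - (8192 - (jhi - (jlo + 8192 * d))) = 0 by omega]
      simp

/-- State of the main loop before window `k`. -/
def Inv (R : Type) [CommRing R] (k base acc : ℕ) : Prop :=
  acc < 1099511627776 ∧ (base : R) = (LL (8192 * k - 1) : ℤ) ∧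
    (acc : R) = ∑ j ∈ Ioc (906150257 / (8192 * k)) 55307, ((gg j : ℤ) : R)

/-- New value of the base. -/
def ltop (B base : ℕ) : ℕ := (base + (2 * (B % 65535) + 1099511619584)) % 1099511627776

lemma runBody_aux (ih : ℕ → ℕ → ℕ → ℕ) (k base acc s F B L jhi jlo D a' k' : ℕ)
    (hs : Nat.mul (nat_lit 8192) k = s) (hF : fieldF s = F) (hB : bitsOf s F = B)
    (hL : Nat.mod (Nat.add base (Nat.add (Nat.mul (nat_lit 2) (Nat.mod B (nat_lit 65535)))
      (nat_lit 1099511619584))) (nat_lit 1099511627776) = L)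
    (hjhi : Nat.div (nat_lit 906150257) s = jhi)
    (hjlo : Nat.div (nat_lit 906150257) (Nat.add s (nat_lit 8192)) = jlo)
    (hD : Nat.div (Nat.add (Nat.sub jhi jlo) (nat_lit 8191)) (nat_lit 8192) = D)
    (ha : Nat.mod (jrange B L s jlo jhi D acc) (nat_lit 1099511627776) = a')
    (hk : Nat.add k (nat_lit 1) = k') :
    runBody ih k base acc = ih k' L a' := by
  unfold runBody
  rw [force_eq, hs, force_eq, hF, force_eq, hB, force_eq, hL, force_eq, hjhi, force_eq, hjlo,
    force_eq, hD, force_eq, ha, force_eq, hk]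

lemma run_zero (k base acc : ℕ) : run 0 k base acc = acc + 1099511627776 * base := rfl

lemma run_succ (n k base acc : ℕ) : run (n + 1) k base acc = runBody (run n) k base acc := rfl

lemma mod_aux (m : ℕ) : Nat.mod m (nat_lit 1099511627776) = m % 1099511627776 := rfl

lemma run_succ2 (n k base acc s F B L jhi jlo D a' : ℕ)
    (hs : 8192 * k = s) (hF : fieldF s = F) (hB : bitsOf s F = B)
    (hL : ltop B base = L) (hjhi : 906150257 / s = jhi) (hjlo : 906150257 / (s + 8192) = jlo)
    (hD : (jhi - jlo + 8191) / 8192 = D)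
    (ha : jrange B L s jlo jhi D acc % 1099511627776 = a') :
    run (n + 1) k base acc = run n (k + 1) L a' := by
  rw [run_succ]
  refine runBody_aux (run n) k base acc s F B L jhi jlo D a' (k + 1) hs hF hB hL hjhi hjlo hD ?_ rfl
  rw [mod_aux]
  exact ha

lemma inv_step (hM : (1099511627776 : R) = 0) (k base acc L jhi jlo D a' : ℕ) (hk : 2 ≤ k)
    (hk2 : k < 368) (h : Inv R k base acc)
    (hL : ltop (pack (bt (8192 * k)) 8192) base = L)
    (hjhi : 906150257 / (8192 * k) = jhi) (hjlo : 906150257 / (8192 * k + 8192) = jlo)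
    (hD : (jhi - jlo + 8191) / 8192 = D)
    (ha' : jrange (pack (bt (8192 * k)) 8192) L (8192 * k) jlo jhi D acc % 1099511627776 = a') :
    Inv R (k + 1) L a' := by
  obtain ⟨_, hb, ha⟩ := h
  have hlt : (L : R) = (LL (8192 * k + 8191) : ℤ) := by
    have hs := pack_tail (8192 * k) 0 8192 (by omega) le_rfl
    rw [mul_zero, Nat.shiftRight_zero] at hs
    rw [← hL, ltop, hs, cast_mod hM]
    have h1 := sum_bits (8192 * k) 0 8192 (by omega) (by
      intro i hi
      exact lam_window k _ (by omega) hk2 (by omega))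
    rw [show 8192 * k + 0 - 1 + 8192 = 8192 * k + 8191 by omega,
      show 8192 * k + 0 - 1 = 8192 * k - 1 by omega] at h1
    rw [Nat.sub_zero]
    generalize (∑ i ∈ range 8192, bt (8192 * k) (0 + i)) = S at *
    rw [h1]
    push_cast
    rw [hb]
    linear_combination hM
  have hle : jlo ≤ jhi := by
    rw [← hjlo, ← hjhi]
    exact Nat.div_le_div_left (by omega) (by omega)
  have hle2 : jhi ≤ 55307 := by
    have : 906150257 / (8192 * k) ≤ 906150257 / 16384 := Nat.div_le_div_left (by omega) (by omega)
    rw [← hjhi]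
    simpa using this
  rw [← ha']
  refine ⟨Nat.mod_lt _ (by norm_num), ?_, ?_⟩
  · rw [hlt]
    congr 2
  · rw [cast_mod hM, jrange_cast hM k _ _ _ _ _ (by omega) hk2 hle _ hlt, ha,
      show 8192 * (k + 1) = 8192 * k + 8192 by ring, hjhi, hjlo, min_eq_left (by omega),
      ← Finset.sum_Ioc_consecutive _ hle hle2]
    · ring
    · intro j h1 h2
      have hj : 0 < j := by omega
      rw [← hjhi] at h2
      rw [← hjlo] at h1
      rw [Nat.le_div_iff_mul_le (by omega)] at h2
      rw [Nat.div_lt_iff_lt_mul (by omega)] at h1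
      rw [Nat.le_div_iff_mul_le hj, Nat.div_lt_iff_lt_mul hj]
      constructor
      · rw [mul_comm]; exact h2
      · rw [mul_comm]; exact h1

lemma run_spec (hM : (1099511627776 : R) = 0) (n k base acc : ℕ) (hk : 2 ≤ k) (hk2 : k + n ≤ 368)
    (h : Inv R k base acc) :
    ∃ b a, run n k base acc = a + 1099511627776 * b ∧ Inv R (k + n) b a := by
  induction n generalizing k base acc with
  | zero => exact ⟨base, acc, run_zero k base acc, h⟩
  | succ n ih =>
    have hB := bitsOf_eq (8192 * k) (by omega)
    obtain ⟨L, hL⟩ : ∃ L, ltop (pack (bt (8192 * k)) 8192) base = L := ⟨_, rfl⟩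
    obtain ⟨jhi, hjhi⟩ : ∃ j, 906150257 / (8192 * k) = j := ⟨_, rfl⟩
    obtain ⟨jlo, hjlo⟩ : ∃ j, 906150257 / (8192 * k + 8192) = j := ⟨_, rfl⟩
    obtain ⟨D, hD⟩ : ∃ D, (jhi - jlo + 8191) / 8192 = D := ⟨_, rfl⟩
    obtain ⟨a', ha'⟩ : ∃ a, jrange (pack (bt (8192 * k)) 8192) L (8192 * k) jlo jhi D acc
      % 1099511627776 = a := ⟨_, rfl⟩
    rw [run_succ2 n k base acc _ _ _ L jhi jlo D a' rfl rfl hB hL hjhi hjlo hD ha',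
      show k + (n + 1) = k + 1 + n by ring]
    exact ih _ _ _ (by omega) (by omega)
      (inv_step hM k base acc L jhi jlo D a' hk (by omega) h hL hjhi hjlo hD ha')

lemma inv_of_run (hM : (1099511627776 : R) = 0) (n k base acc b a : ℕ) (hk : 2 ≤ k)
    (hk2 : k + n ≤ 368) (ha : a < 1099511627776) (h : Inv R k base acc)
    (hr : Nat.beq (run n k base acc) (Nat.add a (Nat.mul 1099511627776 b)) = true) :
    Inv R (k + n) b a := by
  obtain ⟨b', a', h1, h2⟩ := run_spec hM n k base acc hk hk2 h
  have h3 : run n k base acc = a + 1099511627776 * b := Nat.eq_of_beq_eq_true hr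
  have h4 := h2.1
  have h5 : a' = a := by omega
  have h6 : b' = b := by omega
  rw [← h5, ← h6]
  exact h2

/-- `C(t)` -/
def CC (t : ℕ) : ℤ := (cum WP t : ℤ) - cum WN t

lemma cumC_cast (hM : (1099511627776 : R) = 0) (t : ℕ) : (cumC t : R) = (CC t : ℤ) := by
  have h : cumC t = csP t + 1099511627775 * csN t := rfl
  rw [h, csP_eq, csN_eq, CC]
  push_cast
  linear_combination (cum WN t : R) * hM

/-- The summand attached to `a`. -/
def ga (a : ℕ) : ℤ := liouvilleFn a * (CC (906150257 / a) - CC 55307)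

lemma lam_window2 (κ i : ℕ) (hk2 : κ < 8) (hi : i < 2048) (h1 : 1 ≤ 2048 * κ + i) :
    liouvilleFn (2048 * κ + i) = 2 * (bt (2048 * κ) i : ℤ) - 1 := by
  refine bt_spec _ _ h1 (by omega) ?_
  rcases Nat.eq_zero_or_pos κ with rfl | hk
  · exact Or.inr ⟨by omega, hi⟩
  · left
    have := log2_window 11 κ i hk (by omega)
    rwa [show 2 ^ 11 = 2048 by norm_num] at this

lemma force_of {x y r : ℕ} {k : ℕ → ℕ} (h : x = y) (h2 : k y = r) : force x k = r := by
  rw [force_eq, h, h2]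

lemma aterm_aux (B s a w P T Q : ℕ) :
    Nat.mul (Nat.add (Nat.mul T (Nat.mod (Nat.shiftRight B (Nat.mul P (Nat.sub a s))) T)) Q) w
      = (T * (B >>> (P * (a - s)) % T) + Q) * w := rfl

lemma aterm_eq (B s cJ a : ℕ) : aterm B s cJ a
    = (2 * (B >>> (16 * (a - s)) % 2) + 1099511627775) * (cumC (906150257 / a) + cJ) := by
  unfold aterm
  refine (aterm_aux B s a _ _ _ _).trans ?_
  congr 1

lemma aterm_cast (hM : (1099511627776 : R) = 0) (κ a cJ : ℕ) (hk2 : κ < 8) (h1 : 1 ≤ a)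
    (ha : 2048 * κ ≤ a) (ha2 : a < 2048 * κ + 2048) (hJ : (cJ : R) = (- CC 55307 : ℤ)) :
    (aterm (pack (bt (2048 * κ)) 2048) (2048 * κ) cJ a : R) = (ga a : ℤ) := by
  rw [aterm_eq, pack_digit2 _ _ _ (fun i _ => bt_lt _ i) (by omega), ga]
  have h2 := lam_window2 κ (a - 2048 * κ) hk2 (by omega) (by omega)
  rw [show 2048 * κ + (a - 2048 * κ) = a by omega] at h2
  rw [h2]
  push_cast at hJ ⊢
  rw [cumC_cast hM, hJ]
  linear_combination (((CC (906150257 / a) : ℤ) : R) - ((CC 55307 : ℤ) : R)) * hM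

lemma aloop_eq (B s cJ a1 len acc : ℕ) :
    aloop B s cJ a1 len acc = acc + ∑ i ∈ range len, aterm B s cJ (a1 + i) := by
  induction len generalizing acc with
  | zero => rfl
  | succ n ih =>
    have h : aloop B s cJ a1 (n + 1) acc
      = force (Nat.add acc (aterm B s cJ (Nat.add a1 n))) (aloop B s cJ a1 n) := rfl
    rw [h, force_eq, ih, sum_range_succ]
    have h2 : Nat.add acc (aterm B s cJ (Nat.add a1 n)) = acc + aterm B s cJ (a1 + n) := by
      rw [Nat.add_eq, Nat.add_eq]
    rw [h2]
    ring

/-- State of the first loop before `a = a1`. -/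
def InvA (R : Type) [CommRing R] (a1 base acc : ℕ) : Prop :=
  (base : R) = (LL (a1 - 1) : ℤ) ∧ (acc : R) = ∑ a ∈ Ico 1 a1, ((ga a : ℤ) : R)

lemma out_aux (a' base B a1 s len M P Q T : ℕ) :
    Nat.add a' (Nat.mul M (Nat.mod (Nat.add base (Nat.add (Nat.mul T (Nat.mod (Nat.shiftRight B
      (Nat.mul P (Nat.sub a1 s))) Q)) (Nat.sub M len))) M))
    = a' + M * ((base + (T * (B >>> (P * (a1 - s)) % Q) + (M - len))) % M) := rfl

lemma runA_eq (s a1 len base acc F B cJ a' : ℕ) (hF : fieldF s = F)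
    (hB : Nat.mod (bitsOf s F) (Nat.pow (nat_lit 2) (nat_lit 32768)) = B)
    (hJ : Nat.mul (nat_lit 1099511627775) (cumC (nat_lit 55307)) = cJ)
    (ha : Nat.mod (aloop B s cJ a1 len acc) (nat_lit 1099511627776) = a') :
    runA s a1 len base acc = a' + 1099511627776 *
      ((base + (2 * (B >>> (16 * (a1 - s)) % 65535) + (1099511627776 - len)))
        % 1099511627776) := by
  unfold runA
  exact force_of hF (force_of hB (force_of hJ (force_of ha (out_aux a' base B a1 s len _ _ _ _))))

lemma mod_2048 (f : ℕ → ℕ) (hf : ∀ i, f i < 65536) :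
    Nat.mod (pack f 8192) (Nat.pow (nat_lit 2) (nat_lit 32768)) = pack f 2048 := by
  rw [mod_pow_aux, ← pack_mod f 8192 2048 (fun i _ => hf i) (by omega)]

lemma decode (X Y a b : ℕ) (ha : a < 1099511627776)
    (h : X % 1099511627776 + 1099511627776 * (Y % 1099511627776) = a + 1099511627776 * b) :
    a = X % 1099511627776 ∧ b = Y % 1099511627776 := by omega

lemma inv_of_runA (hM : (1099511627776 : R) = 0) (κ a1 len base acc b a : ℕ) (hk : κ < 8)
    (h1 : 1 ≤ a1) (hs : 2048 * κ ≤ a1) (hlen : a1 + len = 2048 * (κ + 1))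
    (ha : a < 1099511627776) (h : InvA R a1 base acc)
    (hr : Nat.beq (runA (2048 * κ) a1 len base acc) (Nat.add a (Nat.mul 1099511627776 b)) = true) :
    InvA R (2048 * (κ + 1)) b a := by
  have hsz : 2048 * κ < 3014656 := by omega
  have ht : a1 - 2048 * κ ≤ 2048 := by omega
  have htl : 2048 - (a1 - 2048 * κ) = len := by omega
  have hl : len ≤ 1099511627776 := by omega
  have hrg : ∀ i < len, 1 ≤ a1 + i ∧ 2048 * κ ≤ a1 + i ∧ a1 + i < 2048 * κ + 2048 := by
    intro i hi
    omega
  have h4 := sum_bits (2048 * κ) (a1 - 2048 * κ) (2048 - (a1 - 2048 * κ)) (by omega) (by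
    intro i hi
    exact lam_window2 κ _ hk (by omega) (by omega))
  rw [show 2048 * κ + (a1 - 2048 * κ) - 1 = a1 - 1 by omega,
    show 2048 - (a1 - 2048 * κ) = len by omega,
    show a1 - 1 + len = 2048 * (κ + 1) - 1 by omega] at h4
  have h3 : runA (2048 * κ) a1 len base acc = a + 1099511627776 * b := Nat.eq_of_beq_eq_true hr
  have hB := mod_2048 (bt (2048 * κ)) fun i => (bt_lt _ i).trans (by norm_num)
  rw [← bitsOf_eq _ hsz] at hB
  have hJ : ((Nat.mul (nat_lit 1099511627775) (cumC (nat_lit 55307)) : ℕ) : R)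
      = (- CC 55307 : ℤ) := by
    have e : Nat.mul (nat_lit 1099511627775) (cumC (nat_lit 55307))
      = 1099511627775 * cumC 55307 := rfl
    rw [e, Nat.cast_mul, cumC_cast hM]
    push_cast
    linear_combination ((CC 55307 : ℤ) : R) * hM
  obtain ⟨cJ, hcJ⟩ : ∃ c, Nat.mul (nat_lit 1099511627775) (cumC (nat_lit 55307)) = c := ⟨_, rfl⟩
  rw [hcJ] at hJ
  rw [runA_eq _ _ _ _ _ _ _ cJ _ rfl hB hcJ rfl, pack_tail _ _ 2048 ht (by norm_num),
    mod_aux] at h3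
  clear hB hcJ
  rw [htl] at h3
  generalize (∑ i ∈ range len, bt (2048 * κ) (a1 - 2048 * κ + i)) = S at *
  obtain ⟨h5, h6⟩ := decode _ _ _ _ ha h3
  obtain ⟨hb, hacc⟩ := h
  constructor
  · rw [h6, cast_mod hM, h4]
    push_cast [Nat.cast_sub hl]
    rw [hb]
    linear_combination hM
  · rw [h5, cast_mod hM, aloop_eq, Nat.cast_add, Nat.cast_sum, hacc]
    have h7 : ∀ i ∈ range len, ((aterm (pack (bt (2048 * κ)) 2048) (2048 * κ) cJ (a1 + i) : ℕ) : R)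
        = ((ga (a1 + i) : ℤ) : R) := by
      intro i hi
      rw [mem_range] at hi
      exact aterm_cast hM κ _ cJ hk (hrg i hi).1 (hrg i hi).2.1 (hrg i hi).2.2 hJ
    rw [sum_congr rfl h7, ← hlen,
      ← Finset.sum_Ico_consecutive _ h1 (Nat.le_add_right a1 len),
      Finset.sum_Ico_eq_sum_range _ a1 (a1 + len), Nat.add_sub_cancel_left]

end ring

/-! ### Final assembly -/

/-- Integer square roots of `x / m` for `m` in `WP`. -/
def RP : List ℕ := [
   30102, 12289, 9519, 8045, 7772, 6568, 6417, 5903, 5240, 5162, 5088, 4883, 4820, 4438, 4215,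
   4058, 3987, 3952, 3822, 3733, 3623, 3499, 3430, 3324, 3265, 3246, 3227, 3155, 3121, 3104, 3088,
   2923, 2857, 2807, 2771, 2759, 2725, 2714, 2650, 2610, 2600, 2535, 2526, 2517, 2499, 2491, 2417,
   2394, 2387, 2372, 2336, 2262, 2256, 2225, 2213, 2201, 2161, 2123, 2117, 2112, 2102, 2097, 2082,
   2077, 2062, 2057, 2052, 2043, 2038, 2034, 2024, 2002, 1963, 1955, 1915, 1907, 1892, 1888, 1870,
   1859, 1849, 1842, 1818, 1805, 1776, 1764, 1752, 1743, 1740]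
/-- Integer square roots of `x / m` for `m` in `WN`. -/
def RN : List ℕ := [
   21285, 17379, 13462, 11377, 9076, 8348, 7300, 6905, 6276, 5589, 5495, 5406, 4948, 4701, 4644,
   4590, 4390, 4134, 3918, 3854, 3705, 3677, 3597, 3572, 3523, 3408, 3386, 3304, 3190, 3056, 2995,
   2980, 2966, 2937, 2910, 2883, 2870, 2831, 2819, 2671, 2640, 2630, 2571, 2562, 2553, 2466, 2449,
   2425, 2402, 2357, 2343, 2329, 2308, 2288, 2282, 2249, 2237, 2231, 2207, 2183, 2178, 2166, 2155,
   2144, 2133, 2072, 2020, 2015, 1997, 1989, 1984, 1980, 1972, 1951, 1947, 1939, 1919, 1900, 1885,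
   1877, 1874, 1856, 1845, 1835, 1828, 1821, 1808, 1795, 1792, 1789, 1783, 1779, 1767, 1758]

/-- Check a list of integer square roots. -/
def rootsOK (W V : List ℕ) : Bool :=
  (W.zip V).all fun p => Nat.ble (p.2 * p.2) (906150257 / p.1) &&
    Nat.blt (906150257 / p.1) ((p.2 + 1) * (p.2 + 1))

lemma roots_sum (W V : List ℕ) (h : rootsOK W V = true) (hl : W.length = V.length) :
    (W.map fun m => Nat.sqrt (906150257 / m)).sum = V.sum := by
  induction W generalizing V with
  | nil =>
    cases V with
    | nil => rfl
    | cons _ _ => simp at hl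
  | cons m W ih =>
    cases V with
    | nil => simp at hl
    | cons r V =>
      unfold rootsOK at h
      rw [List.zip_cons_cons, List.all_cons, Bool.and_eq_true, Bool.and_eq_true, Nat.ble_eq,
        Nat.blt_eq] at h
      rw [List.map_cons, List.sum_cons, List.sum_cons, ih V h.2 (by simpa using hl)]
      congr 1
      exact (Nat.eq_sqrt.2 h.1).symm

set_option linter.defProp false in
def RP_ok : rootsOK WP RP = true := by decide +kernel
set_option linter.defProp false in
def RN_ok : rootsOK WN RN = true := by decide +kernel

lemma sumP : (WP.map fun m => Nat.sqrt (906150257 / m)).sum = 303663 :=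
  (roots_sum WP RP RP_ok (by decide)).trans (by decide +kernel)

lemma sumN : (WN.map fun m => Nat.sqrt (906150257 / m)).sum = 329622 :=
  (roots_sum WN RN RN_ok (by decide)).trans (by decide +kernel)

set_option linter.defProp false in
def cnt_check : ((List.range 299).all fun i => Nat.beq (cnt WP (i + 2)) (cnt WN (i + 2))) = true := by
  decide +kernel

lemma cnt_zero (j : ℕ) (h2 : 2 ≤ j) (hj : j ≤ 300) : (cnt WP j : ℤ) - cnt WN j = 0 := by
  have h := List.all_eq_true.1 cnt_check (j - 2) (by rw [List.mem_range]; omega)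
  have h3 := Nat.eq_of_beq_eq_true h
  rw [show j - 2 + 2 = j by omega] at h3
  rw [h3, sub_self]

lemma cnt_one : (cnt WP 1 : ℤ) - cnt WN 1 = 1 := by
  have h1 : cnt WP 1 = 1 := by decide +kernel
  have h2 : cnt WN 1 = 0 := by decide +kernel
  rw [h1, h2]; norm_num

lemma main_eq : LL 906150257 = 303663 - 329622 - ∑ j ∈ Ioc 300 55307, gg j - ∑ a ∈ Ico 1 16384, ga a := by
  have h := main_identity WP WN WP_pos WN_pos 906150257 16384 300 (by norm_num) (by norm_num)
    (by norm_num) cnt_one cnt_zero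
  rw [sumP, sumN, show 906150257 / 16384 = 55307 by norm_num] at h
  exact h

lemma LL_abs (y : ℕ) : |LL y| ≤ y := by
  unfold LL
  refine (abs_sum_le_sum_abs _ _).trans ?_
  have : ∀ i ∈ Icc 1 y, |liouvilleFn i| ≤ 1 := by
    intro i _
    unfold liouvilleFn
    rw [abs_neg_one_pow]
  refine (sum_le_sum this).trans ?_
  simp

lemma exists_ring (n : ℕ) : ∃ (R : Type) (_ : CommRing R), (n : R) = 0 ∧
    ∀ z : ℤ, (z : R) = 0 → (n : ℤ) ∣ z :=
  ⟨ZMod n, inferInstance, ZMod.natCast_self n, fun z hz => (ZMod.intCast_zmod_eq_zero_iff_dvd z n).1 hz⟩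

/-- The claimed outcome `(a, b)` of `run` is right. -/
noncomputable def okR (n k base acc a b : ℕ) : Bool :=
  Nat.beq (run n k base acc) (Nat.add a (Nat.mul 1099511627776 b))

/-- The claimed outcome `(a, b)` of `runA` is right. -/
noncomputable def okA (s a1 len base acc a b : ℕ) : Bool :=
  Nat.beq (runA s a1 len base acc) (Nat.add a (Nat.mul 1099511627776 b))

lemma inv_of_run2 {R : Type} [CommRing R] (hM : (1099511627776 : R) = 0)
    (n k k' base acc b a : ℕ) (hk : 2 ≤ k)
    (hk2 : k' ≤ 368) (hkn : k + n = k') (ha : a < 1099511627776) (h : Inv R k base acc)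
    (hr : okR n k base acc a b = true) :
    Inv R k' b a := by
  rw [← hkn] at hk2 ⊢
  exact inv_of_run hM n k base acc b a hk hk2 ha h hr

lemma inv_of_runA2 {R : Type} [CommRing R] (hM : (1099511627776 : R) = 0)
    (κ s a1 len s' base acc b a : ℕ) (hk : κ < 8)
    (h1 : 1 ≤ a1) (hs : s ≤ a1) (hs1 : 2048 * κ = s) (hs2 : 2048 * (κ + 1) = s')
    (hlen : a1 + len = s')
    (ha : a < 1099511627776) (h : InvA R a1 base acc)
    (hr : okA s a1 len base acc a b = true) :
    InvA R s' b a := by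
  rw [← hs2] at hlen ⊢
  rw [← hs1] at hs hr
  exact inv_of_runA hM κ a1 len base acc b a hk h1 hs hlen ha h hr

/-! ### The computation -/

set_option linter.defProp false in
def compA0 : okA 0 1 2047 0 0 1099511433184 1099511627755 = true := by decide +kernel
set_option linter.defProp false in
def compA1 : okA 2048 2048 2048 1099511627755 1099511433184 1099511537574 1099511627711 = true := by decide +kernel
set_option linter.defProp false in
def compA2 : okA 4096 4096 2048 1099511627711 1099511537574 1099511521125 1099511627713 = true := by decide +kernel
set_option linter.defProp false in
def compA3 : okA 6144 6144 2048 1099511627713 1099511521125 1099511498568 1099511627755 = true := by decide +kernel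
set_option linter.defProp false in
def compA4 : okA 8192 8192 2048 1099511627755 1099511498568 1099511532793 1099511627681 = true := by decide +kernel
set_option linter.defProp false in
def compA5 : okA 10240 10240 2048 1099511627681 1099511532793 1099511520726 1099511627733 = true := by decide +kernel
set_option linter.defProp false in
def compA6 : okA 12288 12288 2048 1099511627733 1099511520726 1099511522650 1099511627719 = true := by decide +kernel
set_option linter.defProp false in
def compA7 : okA 14336 14336 2048 1099511627719 1099511522650 1099511526455 1099511627631 = true := by decide +kernel
set_option linter.defProp false in
def comp2 : okR 4 2 1099511627631 0 43486 1099511627763 = true := by decide +kernel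
set_option linter.defProp false in
def comp6 : okR 4 6 1099511627763 43486 55060 1099511627617 = true := by decide +kernel
set_option linter.defProp false in
def comp10 : okR 4 10 1099511627617 55060 63064 1099511627643 = true := by decide +kernel
set_option linter.defProp false in
def comp14 : okR 4 14 1099511627643 63064 67393 1099511627401 = true := by decide +kernel
set_option linter.defProp false in
def comp18 : okR 4 18 1099511627401 67393 70517 1099511627565 = true := by decide +kernel
set_option linter.defProp false in
def comp22 : okR 4 22 1099511627565 70517 71135 1099511627465 = true := by decide +kernel
set_option linter.defProp false in
def comp26 : okR 4 26 1099511627465 71135 72479 1099511627265 = true := by decide +kernel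
set_option linter.defProp false in
def comp30 : okR 4 30 1099511627265 72479 75288 1099511627541 = true := by decide +kernel
set_option linter.defProp false in
def comp34 : okR 4 34 1099511627541 75288 75468 1099511627617 = true := by decide +kernel
set_option linter.defProp false in
def comp38 : okR 4 38 1099511627617 75468 75976 1099511627191 = true := by decide +kernel
set_option linter.defProp false in
def comp42 : okR 4 42 1099511627191 75976 78638 1099511627217 = true := by decide +kernel
set_option linter.defProp false in
def comp46 : okR 4 46 1099511627217 78638 79060 1099511627309 = true := by decide +kernel
set_option linter.defProp false in
def comp50 : okR 4 50 1099511627309 79060 78995 1099511627435 = true := by decide +kernel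
set_option linter.defProp false in
def comp54 : okR 4 54 1099511627435 78995 78975 1099511627525 = true := by decide +kernel
set_option linter.defProp false in
def comp58 : okR 4 58 1099511627525 78975 78546 1099511627325 = true := by decide +kernel
set_option linter.defProp false in
def comp62 : okR 4 62 1099511627325 78546 78183 1099511627121 = true := by decide +kernel
set_option linter.defProp false in
def comp66 : okR 4 66 1099511627121 78183 79037 1099511627095 = true := by decide +kernel
set_option linter.defProp false in
def comp70 : okR 4 70 1099511627095 79037 84828 1099511626949 = true := by decide +kernel
set_option linter.defProp false in
def comp74 : okR 4 74 1099511626949 84828 74346 1099511627141 = true := by decide +kernel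
set_option linter.defProp false in
def comp78 : okR 4 78 1099511627141 74346 79741 1099511627533 = true := by decide +kernel
set_option linter.defProp false in
def comp82 : okR 4 82 1099511627533 79741 78302 1099511627497 = true := by decide +kernel
set_option linter.defProp false in
def comp86 : okR 4 86 1099511627497 78302 78474 1099511627397 = true := by decide +kernel
set_option linter.defProp false in
def comp90 : okR 4 90 1099511627397 78474 77915 1099511627473 = true := by decide +kernel
set_option linter.defProp false in
def comp94 : okR 4 94 1099511627473 77915 83168 1099511627123 = true := by decide +kernel
set_option linter.defProp false in
def comp98 : okR 4 98 1099511627123 83168 79267 1099511626825 = true := by decide +kernel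
set_option linter.defProp false in
def comp102 : okR 4 102 1099511626825 79267 79164 1099511626819 = true := by decide +kernel
set_option linter.defProp false in
def comp106 : okR 4 106 1099511626819 79164 76303 1099511626803 = true := by decide +kernel
set_option linter.defProp false in
def comp110 : okR 4 110 1099511626803 76303 79519 1099511626703 = true := by decide +kernel
set_option linter.defProp false in
def comp114 : okR 4 114 1099511626703 79519 80812 1099511627055 = true := by decide +kernel
set_option linter.defProp false in
def comp118 : okR 4 118 1099511627055 80812 81778 1099511627269 = true := by decide +kernel
set_option linter.defProp false in
def comp122 : okR 4 122 1099511627269 81778 82848 1099511627179 = true := by decide +kernel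
set_option linter.defProp false in
def comp126 : okR 4 126 1099511627179 82848 80816 1099511627515 = true := by decide +kernel
set_option linter.defProp false in
def comp130 : okR 4 130 1099511627515 80816 80526 1099511627333 = true := by decide +kernel
set_option linter.defProp false in
def comp134 : okR 4 134 1099511627333 80526 79081 1099511627193 = true := by decide +kernel
set_option linter.defProp false in
def comp138 : okR 4 138 1099511627193 79081 82440 1099511627213 = true := by decide +kernel
set_option linter.defProp false in
def comp142 : okR 4 142 1099511627213 82440 82353 1099511627103 = true := by decide +kernel
set_option linter.defProp false in
def comp146 : okR 4 146 1099511627103 82353 80905 1099511627287 = true := by decide +kernel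
set_option linter.defProp false in
def comp150 : okR 4 150 1099511627287 80905 81823 1099511626991 = true := by decide +kernel
set_option linter.defProp false in
def comp154 : okR 4 154 1099511626991 81823 81512 1099511626849 = true := by decide +kernel
set_option linter.defProp false in
def comp158 : okR 4 158 1099511626849 81512 86576 1099511626609 = true := by decide +kernel
set_option linter.defProp false in
def comp162 : okR 4 162 1099511626609 86576 90748 1099511626845 = true := by decide +kernel
set_option linter.defProp false in
def comp166 : okR 4 166 1099511626845 90748 87753 1099511626653 = true := by decide +kernel
set_option linter.defProp false in
def comp170 : okR 4 170 1099511626653 87753 81775 1099511626667 = true := by decide +kernel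
set_option linter.defProp false in
def comp174 : okR 4 174 1099511626667 81775 84912 1099511626677 = true := by decide +kernel
set_option linter.defProp false in
def comp178 : okR 4 178 1099511626677 84912 79565 1099511626517 = true := by decide +kernel
set_option linter.defProp false in
def comp182 : okR 4 182 1099511626517 79565 75870 1099511626593 = true := by decide +kernel
set_option linter.defProp false in
def comp186 : okR 4 186 1099511626593 75870 76775 1099511626811 = true := by decide +kernel
set_option linter.defProp false in
def comp190 : okR 4 190 1099511626811 76775 75900 1099511627041 = true := by decide +kernel
set_option linter.defProp false in
def comp194 : okR 4 194 1099511627041 75900 77194 1099511627221 = true := by decide +kernel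
set_option linter.defProp false in
def comp198 : okR 4 198 1099511627221 77194 78034 1099511627363 = true := by decide +kernel
set_option linter.defProp false in
def comp202 : okR 4 202 1099511627363 78034 79785 1099511627327 = true := by decide +kernel
set_option linter.defProp false in
def comp206 : okR 4 206 1099511627327 79785 80190 1099511627267 = true := by decide +kernel
set_option linter.defProp false in
def comp210 : okR 4 210 1099511627267 80190 80286 1099511627279 = true := by decide +kernel
set_option linter.defProp false in
def comp214 : okR 4 214 1099511627279 80286 81257 1099511627419 = true := by decide +kernel
set_option linter.defProp false in
def comp218 : okR 4 218 1099511627419 81257 81201 1099511627331 = true := by decide +kernel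
set_option linter.defProp false in
def comp222 : okR 4 222 1099511627331 81201 80909 1099511627599 = true := by decide +kernel
set_option linter.defProp false in
def comp226 : okR 4 226 1099511627599 80909 81960 1099511627039 = true := by decide +kernel
set_option linter.defProp false in
def comp230 : okR 4 230 1099511627039 81960 82021 1099511626853 = true := by decide +kernel
set_option linter.defProp false in
def comp234 : okR 4 234 1099511626853 82021 81891 1099511626689 = true := by decide +kernel
set_option linter.defProp false in
def comp238 : okR 4 238 1099511626689 81891 81846 1099511626607 = true := by decide +kernel
set_option linter.defProp false in
def comp242 : okR 4 242 1099511626607 81846 83172 1099511626375 = true := by decide +kernel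
set_option linter.defProp false in
def comp246 : okR 4 246 1099511626375 83172 84771 1099511626553 = true := by decide +kernel
set_option linter.defProp false in
def comp250 : okR 4 250 1099511626553 84771 82247 1099511626079 = true := by decide +kernel
set_option linter.defProp false in
def comp254 : okR 4 254 1099511626079 82247 72011 1099511626075 = true := by decide +kernel
set_option linter.defProp false in
def comp258 : okR 4 258 1099511626075 72011 71965 1099511626203 = true := by decide +kernel
set_option linter.defProp false in
def comp262 : okR 4 262 1099511626203 71965 70549 1099511626355 = true := by decide +kernel
set_option linter.defProp false in
def comp266 : okR 4 266 1099511626355 70549 73356 1099511626311 = true := by decide +kernel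
set_option linter.defProp false in
def comp270 : okR 4 270 1099511626311 73356 71902 1099511626305 = true := by decide +kernel
set_option linter.defProp false in
def comp274 : okR 4 274 1099511626305 71902 70674 1099511626341 = true := by decide +kernel
set_option linter.defProp false in
def comp278 : okR 4 278 1099511626341 70674 73657 1099511626235 = true := by decide +kernel
set_option linter.defProp false in
def comp282 : okR 4 282 1099511626235 73657 75069 1099511626663 = true := by decide +kernel
set_option linter.defProp false in
def comp286 : okR 4 286 1099511626663 75069 75003 1099511626847 = true := by decide +kernel
set_option linter.defProp false in
def comp290 : okR 4 290 1099511626847 75003 75904 1099511626763 = true := by decide +kernel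
set_option linter.defProp false in
def comp294 : okR 4 294 1099511626763 75904 73626 1099511626709 = true := by decide +kernel
set_option linter.defProp false in
def comp298 : okR 4 298 1099511626709 73626 72365 1099511626645 = true := by decide +kernel
set_option linter.defProp false in
def comp302 : okR 4 302 1099511626645 72365 73151 1099511626999 = true := by decide +kernel
set_option linter.defProp false in
def comp306 : okR 4 306 1099511626999 73151 72575 1099511627069 = true := by decide +kernel
set_option linter.defProp false in
def comp310 : okR 4 310 1099511627069 72575 71913 1099511627137 = true := by decide +kernel
set_option linter.defProp false in
def comp314 : okR 4 314 1099511627137 71913 71350 1099511627185 = true := by decide +kernel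
set_option linter.defProp false in
def comp318 : okR 4 318 1099511627185 71350 70865 1099511627261 = true := by decide +kernel
set_option linter.defProp false in
def comp322 : okR 4 322 1099511627261 70865 71485 1099511627121 = true := by decide +kernel
set_option linter.defProp false in
def comp326 : okR 4 326 1099511627121 71485 71619 1099511627285 = true := by decide +kernel
set_option linter.defProp false in
def comp330 : okR 4 330 1099511627285 71619 72793 1099511627089 = true := by decide +kernel
set_option linter.defProp false in
def comp334 : okR 4 334 1099511627089 72793 73470 1099511627219 = true := by decide +kernel
set_option linter.defProp false in
def comp338 : okR 4 338 1099511627219 73470 74493 1099511627263 = true := by decide +kernel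
set_option linter.defProp false in
def comp342 : okR 4 342 1099511627263 74493 75155 1099511626845 = true := by decide +kernel
set_option linter.defProp false in
def comp346 : okR 4 346 1099511626845 75155 73902 1099511626711 = true := by decide +kernel
set_option linter.defProp false in
def comp350 : okR 4 350 1099511626711 73902 73996 1099511626665 = true := by decide +kernel
set_option linter.defProp false in
def comp354 : okR 4 354 1099511626665 73996 72772 1099511626611 = true := by decide +kernel
set_option linter.defProp false in
def comp358 : okR 4 358 1099511626611 72772 71597 1099511626681 = true := by decide +kernel
set_option linter.defProp false in
def comp362 : okR 4 362 1099511626681 71597 73631 1099511626801 = true := by decide +kernel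
set_option linter.defProp false in
def comp366 : okR 2 366 1099511626801 73631 75361 1099511626953 = true := by decide +kernel

lemma invA_all {R : Type} [CommRing R] (hM : (1099511627776 : R) = 0) :
    InvA R 16384 1099511627631 1099511526455 := by
  have hi : InvA R 1 0 0 := by
    refine ⟨?_, ?_⟩
    · simp [LL]
    · simp
  have h0 := inv_of_runA2 hM 0 0 1 2047 2048 _ _ _ _
    (by norm_num) (by norm_num) (by norm_num) rfl rfl rfl (by norm_num) hi compA0
  have h1 := inv_of_runA2 hM 1 2048 2048 2048 4096 _ _ _ _
    (by norm_num) (by norm_num) (by norm_num) rfl rfl rfl (by norm_num) h0 compA1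
  have h2 := inv_of_runA2 hM 2 4096 4096 2048 6144 _ _ _ _
    (by norm_num) (by norm_num) (by norm_num) rfl rfl rfl (by norm_num) h1 compA2
  have h3 := inv_of_runA2 hM 3 6144 6144 2048 8192 _ _ _ _
    (by norm_num) (by norm_num) (by norm_num) rfl rfl rfl (by norm_num) h2 compA3
  have h4 := inv_of_runA2 hM 4 8192 8192 2048 10240 _ _ _ _
    (by norm_num) (by norm_num) (by norm_num) rfl rfl rfl (by norm_num) h3 compA4
  have h5 := inv_of_runA2 hM 5 10240 10240 2048 12288 _ _ _ _
    (by norm_num) (by norm_num) (by norm_num) rfl rfl rfl (by norm_num) h4 compA5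
  have h6 := inv_of_runA2 hM 6 12288 12288 2048 14336 _ _ _ _
    (by norm_num) (by norm_num) (by norm_num) rfl rfl rfl (by norm_num) h5 compA6
  have h7 := inv_of_runA2 hM 7 14336 14336 2048 16384 _ _ _ _
    (by norm_num) (by norm_num) (by norm_num) rfl rfl rfl (by norm_num) h6 compA7
  exact h7

lemma inv_all {R : Type} [CommRing R] (hM : (1099511627776 : R) = 0) :
    Inv R 368 1099511626953 75361 := by
  have h2 : Inv R 2 1099511627631 0 := by
    refine ⟨by norm_num, (invA_all hM).1, ?_⟩
    rw [show 906150257 / (8192 * 2) = 55307 by norm_num]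
    simp
  have h6 := inv_of_run2 hM 4 2 6 _ _ _ _
    (by norm_num) (by norm_num) rfl (by norm_num) h2 comp2
  have h10 := inv_of_run2 hM 4 6 10 _ _ _ _
    (by norm_num) (by norm_num) rfl (by norm_num) h6 comp6
  have h14 := inv_of_run2 hM 4 10 14 _ _ _ _
    (by norm_num) (by norm_num) rfl (by norm_num) h10 comp10
  have h18 := inv_of_run2 hM 4 14 18 _ _ _ _
    (by norm_num) (by norm_num) rfl (by norm_num) h14 comp14
  have h22 := inv_of_run2 hM 4 18 22 _ _ _ _
    (by norm_num) (by norm_num) rfl (by norm_num) h18 comp18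
  have h26 := inv_of_run2 hM 4 22 26 _ _ _ _
    (by norm_num) (by norm_num) rfl (by norm_num) h22 comp22
  have h30 := inv_of_run2 hM 4 26 30 _ _ _ _
    (by norm_num) (by norm_num) rfl (by norm_num) h26 comp26
  have h34 := inv_of_run2 hM 4 30 34 _ _ _ _
    (by norm_num) (by norm_num) rfl (by norm_num) h30 comp30
  have h38 := inv_of_run2 hM 4 34 38 _ _ _ _
    (by norm_num) (by norm_num) rfl (by norm_num) h34 comp34
  have h42 := inv_of_run2 hM 4 38 42 _ _ _ _
    (by norm_num) (by norm_num) rfl (by norm_num) h38 comp38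
  have h46 := inv_of_run2 hM 4 42 46 _ _ _ _
    (by norm_num) (by norm_num) rfl (by norm_num) h42 comp42
  have h50 := inv_of_run2 hM 4 46 50 _ _ _ _
    (by norm_num) (by norm_num) rfl (by norm_num) h46 comp46
  have h54 := inv_of_run2 hM 4 50 54 _ _ _ _
    (by norm_num) (by norm_num) rfl (by norm_num) h50 comp50
  have h58 := inv_of_run2 hM 4 54 58 _ _ _ _
    (by norm_num) (by norm_num) rfl (by norm_num) h54 comp54
  have h62 := inv_of_run2 hM 4 58 62 _ _ _ _
    (by norm_num) (by norm_num) rfl (by norm_num) h58 comp58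
  have h66 := inv_of_run2 hM 4 62 66 _ _ _ _
    (by norm_num) (by norm_num) rfl (by norm_num) h62 comp62
  have h70 := inv_of_run2 hM 4 66 70 _ _ _ _
    (by norm_num) (by norm_num) rfl (by norm_num) h66 comp66
  have h74 := inv_of_run2 hM 4 70 74 _ _ _ _
    (by norm_num) (by norm_num) rfl (by norm_num) h70 comp70
  have h78 := inv_of_run2 hM 4 74 78 _ _ _ _
    (by norm_num) (by norm_num) rfl (by norm_num) h74 comp74
  have h82 := inv_of_run2 hM 4 78 82 _ _ _ _
    (by norm_num) (by norm_num) rfl (by norm_num) h78 comp78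
  have h86 := inv_of_run2 hM 4 82 86 _ _ _ _
    (by norm_num) (by norm_num) rfl (by norm_num) h82 comp82
  have h90 := inv_of_run2 hM 4 86 90 _ _ _ _
    (by norm_num) (by norm_num) rfl (by norm_num) h86 comp86
  have h94 := inv_of_run2 hM 4 90 94 _ _ _ _
    (by norm_num) (by norm_num) rfl (by norm_num) h90 comp90
  have h98 := inv_of_run2 hM 4 94 98 _ _ _ _
    (by norm_num) (by norm_num) rfl (by norm_num) h94 comp94
  have h102 := inv_of_run2 hM 4 98 102 _ _ _ _
    (by norm_num) (by norm_num) rfl (by norm_num) h98 comp98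
  have h106 := inv_of_run2 hM 4 102 106 _ _ _ _
    (by norm_num) (by norm_num) rfl (by norm_num) h102 comp102
  have h110 := inv_of_run2 hM 4 106 110 _ _ _ _
    (by norm_num) (by norm_num) rfl (by norm_num) h106 comp106
  have h114 := inv_of_run2 hM 4 110 114 _ _ _ _
    (by norm_num) (by norm_num) rfl (by norm_num) h110 comp110
  have h118 := inv_of_run2 hM 4 114 118 _ _ _ _
    (by norm_num) (by norm_num) rfl (by norm_num) h114 comp114
  have h122 := inv_of_run2 hM 4 118 122 _ _ _ _
    (by norm_num) (by norm_num) rfl (by norm_num) h118 comp118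
  have h126 := inv_of_run2 hM 4 122 126 _ _ _ _
    (by norm_num) (by norm_num) rfl (by norm_num) h122 comp122
  have h130 := inv_of_run2 hM 4 126 130 _ _ _ _
    (by norm_num) (by norm_num) rfl (by norm_num) h126 comp126
  have h134 := inv_of_run2 hM 4 130 134 _ _ _ _
    (by norm_num) (by norm_num) rfl (by norm_num) h130 comp130
  have h138 := inv_of_run2 hM 4 134 138 _ _ _ _
    (by norm_num) (by norm_num) rfl (by norm_num) h134 comp134
  have h142 := inv_of_run2 hM 4 138 142 _ _ _ _
    (by norm_num) (by norm_num) rfl (by norm_num) h138 comp138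
  have h146 := inv_of_run2 hM 4 142 146 _ _ _ _
    (by norm_num) (by norm_num) rfl (by norm_num) h142 comp142
  have h150 := inv_of_run2 hM 4 146 150 _ _ _ _
    (by norm_num) (by norm_num) rfl (by norm_num) h146 comp146
  have h154 := inv_of_run2 hM 4 150 154 _ _ _ _
    (by norm_num) (by norm_num) rfl (by norm_num) h150 comp150
  have h158 := inv_of_run2 hM 4 154 158 _ _ _ _
    (by norm_num) (by norm_num) rfl (by norm_num) h154 comp154
  have h162 := inv_of_run2 hM 4 158 162 _ _ _ _
    (by norm_num) (by norm_num) rfl (by norm_num) h158 comp158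
  have h166 := inv_of_run2 hM 4 162 166 _ _ _ _
    (by norm_num) (by norm_num) rfl (by norm_num) h162 comp162
  have h170 := inv_of_run2 hM 4 166 170 _ _ _ _
    (by norm_num) (by norm_num) rfl (by norm_num) h166 comp166
  have h174 := inv_of_run2 hM 4 170 174 _ _ _ _
    (by norm_num) (by norm_num) rfl (by norm_num) h170 comp170
  have h178 := inv_of_run2 hM 4 174 178 _ _ _ _
    (by norm_num) (by norm_num) rfl (by norm_num) h174 comp174
  have h182 := inv_of_run2 hM 4 178 182 _ _ _ _
    (by norm_num) (by norm_num) rfl (by norm_num) h178 comp178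
  have h186 := inv_of_run2 hM 4 182 186 _ _ _ _
    (by norm_num) (by norm_num) rfl (by norm_num) h182 comp182
  have h190 := inv_of_run2 hM 4 186 190 _ _ _ _
    (by norm_num) (by norm_num) rfl (by norm_num) h186 comp186
  have h194 := inv_of_run2 hM 4 190 194 _ _ _ _
    (by norm_num) (by norm_num) rfl (by norm_num) h190 comp190
  have h198 := inv_of_run2 hM 4 194 198 _ _ _ _
    (by norm_num) (by norm_num) rfl (by norm_num) h194 comp194
  have h202 := inv_of_run2 hM 4 198 202 _ _ _ _
    (by norm_num) (by norm_num) rfl (by norm_num) h198 comp198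
  have h206 := inv_of_run2 hM 4 202 206 _ _ _ _
    (by norm_num) (by norm_num) rfl (by norm_num) h202 comp202
  have h210 := inv_of_run2 hM 4 206 210 _ _ _ _
    (by norm_num) (by norm_num) rfl (by norm_num) h206 comp206
  have h214 := inv_of_run2 hM 4 210 214 _ _ _ _
    (by norm_num) (by norm_num) rfl (by norm_num) h210 comp210
  have h218 := inv_of_run2 hM 4 214 218 _ _ _ _
    (by norm_num) (by norm_num) rfl (by norm_num) h214 comp214
  have h222 := inv_of_run2 hM 4 218 222 _ _ _ _
    (by norm_num) (by norm_num) rfl (by norm_num) h218 comp218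
  have h226 := inv_of_run2 hM 4 222 226 _ _ _ _
    (by norm_num) (by norm_num) rfl (by norm_num) h222 comp222
  have h230 := inv_of_run2 hM 4 226 230 _ _ _ _
    (by norm_num) (by norm_num) rfl (by norm_num) h226 comp226
  have h234 := inv_of_run2 hM 4 230 234 _ _ _ _
    (by norm_num) (by norm_num) rfl (by norm_num) h230 comp230
  have h238 := inv_of_run2 hM 4 234 238 _ _ _ _
    (by norm_num) (by norm_num) rfl (by norm_num) h234 comp234
  have h242 := inv_of_run2 hM 4 238 242 _ _ _ _
    (by norm_num) (by norm_num) rfl (by norm_num) h238 comp238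
  have h246 := inv_of_run2 hM 4 242 246 _ _ _ _
    (by norm_num) (by norm_num) rfl (by norm_num) h242 comp242
  have h250 := inv_of_run2 hM 4 246 250 _ _ _ _
    (by norm_num) (by norm_num) rfl (by norm_num) h246 comp246
  have h254 := inv_of_run2 hM 4 250 254 _ _ _ _
    (by norm_num) (by norm_num) rfl (by norm_num) h250 comp250
  have h258 := inv_of_run2 hM 4 254 258 _ _ _ _
    (by norm_num) (by norm_num) rfl (by norm_num) h254 comp254
  have h262 := inv_of_run2 hM 4 258 262 _ _ _ _
    (by norm_num) (by norm_num) rfl (by norm_num) h258 comp258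
  have h266 := inv_of_run2 hM 4 262 266 _ _ _ _
    (by norm_num) (by norm_num) rfl (by norm_num) h262 comp262
  have h270 := inv_of_run2 hM 4 266 270 _ _ _ _
    (by norm_num) (by norm_num) rfl (by norm_num) h266 comp266
  have h274 := inv_of_run2 hM 4 270 274 _ _ _ _
    (by norm_num) (by norm_num) rfl (by norm_num) h270 comp270
  have h278 := inv_of_run2 hM 4 274 278 _ _ _ _
    (by norm_num) (by norm_num) rfl (by norm_num) h274 comp274
  have h282 := inv_of_run2 hM 4 278 282 _ _ _ _
    (by norm_num) (by norm_num) rfl (by norm_num) h278 comp278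
  have h286 := inv_of_run2 hM 4 282 286 _ _ _ _
    (by norm_num) (by norm_num) rfl (by norm_num) h282 comp282
  have h290 := inv_of_run2 hM 4 286 290 _ _ _ _
    (by norm_num) (by norm_num) rfl (by norm_num) h286 comp286
  have h294 := inv_of_run2 hM 4 290 294 _ _ _ _
    (by norm_num) (by norm_num) rfl (by norm_num) h290 comp290
  have h298 := inv_of_run2 hM 4 294 298 _ _ _ _
    (by norm_num) (by norm_num) rfl (by norm_num) h294 comp294
  have h302 := inv_of_run2 hM 4 298 302 _ _ _ _
    (by norm_num) (by norm_num) rfl (by norm_num) h298 comp298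
  have h306 := inv_of_run2 hM 4 302 306 _ _ _ _
    (by norm_num) (by norm_num) rfl (by norm_num) h302 comp302
  have h310 := inv_of_run2 hM 4 306 310 _ _ _ _
    (by norm_num) (by norm_num) rfl (by norm_num) h306 comp306
  have h314 := inv_of_run2 hM 4 310 314 _ _ _ _
    (by norm_num) (by norm_num) rfl (by norm_num) h310 comp310
  have h318 := inv_of_run2 hM 4 314 318 _ _ _ _
    (by norm_num) (by norm_num) rfl (by norm_num) h314 comp314
  have h322 := inv_of_run2 hM 4 318 322 _ _ _ _
    (by norm_num) (by norm_num) rfl (by norm_num) h318 comp318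
  have h326 := inv_of_run2 hM 4 322 326 _ _ _ _
    (by norm_num) (by norm_num) rfl (by norm_num) h322 comp322
  have h330 := inv_of_run2 hM 4 326 330 _ _ _ _
    (by norm_num) (by norm_num) rfl (by norm_num) h326 comp326
  have h334 := inv_of_run2 hM 4 330 334 _ _ _ _
    (by norm_num) (by norm_num) rfl (by norm_num) h330 comp330
  have h338 := inv_of_run2 hM 4 334 338 _ _ _ _
    (by norm_num) (by norm_num) rfl (by norm_num) h334 comp334
  have h342 := inv_of_run2 hM 4 338 342 _ _ _ _
    (by norm_num) (by norm_num) rfl (by norm_num) h338 comp338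
  have h346 := inv_of_run2 hM 4 342 346 _ _ _ _
    (by norm_num) (by norm_num) rfl (by norm_num) h342 comp342
  have h350 := inv_of_run2 hM 4 346 350 _ _ _ _
    (by norm_num) (by norm_num) rfl (by norm_num) h346 comp346
  have h354 := inv_of_run2 hM 4 350 354 _ _ _ _
    (by norm_num) (by norm_num) rfl (by norm_num) h350 comp350
  have h358 := inv_of_run2 hM 4 354 358 _ _ _ _
    (by norm_num) (by norm_num) rfl (by norm_num) h354 comp354
  have h362 := inv_of_run2 hM 4 358 362 _ _ _ _
    (by norm_num) (by norm_num) rfl (by norm_num) h358 comp358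
  have h366 := inv_of_run2 hM 4 362 366 _ _ _ _
    (by norm_num) (by norm_num) rfl (by norm_num) h362 comp362
  have h368 := inv_of_run2 hM 2 366 368 _ _ _ _
    (by norm_num) (by norm_num) rfl (by norm_num) h366 comp366
  exact h368

lemma LL_one : LL 906150257 = 1 := by
  obtain ⟨R, _, h0, hd⟩ := exists_ring 1099511627776
  have hM : (1099511627776 : R) = 0 := by
    rw [← h0]
    norm_cast
  have hA := (invA_all hM).2
  have hB := (inv_all hM).2.2
  rw [show 906150257 / (8192 * 368) = 300 by norm_num] at hB
  have h := congrArg (Int.cast (R := R)) main_eq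
  push_cast at h hA hB
  rw [← hA, ← hB] at h
  have hz : ((LL 906150257 - 1 : ℤ) : R) = 0 := by
    push_cast
    rw [h]
    linear_combination (-1) * hM
  have h1 := hd _ hz
  have h2 := abs_le.1 (LL_abs 906150257)
  push_cast at h1 h2
  omega

end Pol

/-- Pólya's inequality fails for the Liouville function: there exists `n ≥ 2`
(e.g. `n = 906150257`) with `∑_{i=1}^{n} λ(i) > 0`. -/
theorem polya_inequality_fails :
    ∃ n : ℕ, 2 ≤ n ∧ 0 < ∑ i ∈ Finset.Icc 1 n, liouvilleFn i := by
  exact ⟨906150257, by norm_num, by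
    have h := Pol.LL_one
    unfold Pol.LL at h
    rw [h]
    exact one_pos⟩
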